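/- For every integer n ≥ 0, ζ⋆({1,3}^n, 1, 2) = (4 − 16^{−n})·ζ(4n+3) + (8/(3ζ(2))) · ∑_{a+b+2c = 2n+1, a,b,c ≥ 0} (−1)^{a+c}(1 − 2^{2a})·4^{−(a+b+c)}·ζ(2a)ζ(2b)ζ(4c+3). -/

import Mathlib

/-- The monotone index sequence `n_0 ≤ n_1 ≤ ⋯` of positive integers parametrized by the
gap function `g`: `n i = 1 + g 0 + g 1 + ⋯ + g i`.  Every weakly increasing tuple
`1 ≤ n_0 ≤ ⋯ ≤ n_{d−1}` arises from exactly one `g : Fin d → ℕ`. -/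
def idxSeq {d : ℕ} (g : Fin d → ℕ) (i : Fin d) : ℕ :=
  1 + ∑ j ∈ Finset.univ.filter (· ≤ i), g j

/-- The multiple zeta star value
`ζ⋆(s₁,…,s_d) = ∑_{1 ≤ n₁ ≤ n₂ ≤ ⋯ ≤ n_d} 1/(n₁^{s₁} ⋯ n_d^{s_d})`. -/
noncomputable def zetaStar {d : ℕ} (s : Fin d → ℕ) : ℝ :=
  ∑' g : Fin d → ℕ, ∏ i, 1 / (idxSeq g i : ℝ) ^ s i

/-- The repeating string `{1,3}^n`: entries alternate `1, 3, 1, 3, …` (length `2n`). -/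
def pat13 (n : ℕ) : Fin (2 * n) → ℕ := fun i => if (i : ℕ) % 2 = 0 then 1 else 3

section
open Filter Topology Finset
namespace ZS

noncomputable def eP (Y x : ℂ) (m : ℕ) : ℂ :=
  ∏ j ∈ range m, ((((2*j+2 : ℕ):ℂ)^2+Y)*(((2*j+1 : ℕ):ℂ)^2-x^2)) /
    ((((2*j+2 : ℕ):ℂ)^2-x^2)*(((2*j+1 : ℕ):ℂ)^2+Y))

noncomputable def eN (Y x : ℂ) (n : ℕ) : ℂ :=
  ∏ j ∈ range n, ((((2*j : ℕ):ℂ)^2-x^2)*(((2*j+1 : ℕ):ℂ)^2+Y)) /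
    ((((2*j : ℕ):ℂ)^2+Y)*(((2*j+1 : ℕ):ℂ)^2-x^2))

noncomputable def wt (Y k : ℂ) : ℂ := 1/(k*(k^2+Y)) + 1/((k+1)*((k+1)^2+Y))

noncomputable def FP (Y x : ℂ) (m : ℕ) : ℂ := eP Y x m * wt Y ((2*m : ℕ):ℂ)

noncomputable def FN (Y x : ℂ) (n : ℕ) : ℂ := eN Y x (n+1) * wt Y (-((2*n+2 : ℕ):ℂ))

noncomputable def RR (x k : ℂ) : ℂ := ((x+2)*(k+1+x)*(k-x))/(x*(k-1-x)*(k+2+x))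

noncomputable def DD (Y x : ℂ) : ℂ := (x^2+Y)*((x+2)^2+Y)
noncomputable def p1 (Y x : ℂ) : ℂ := -(2/x)*(1+Y+(x+1)^2)/DD Y x
noncomputable def p0 (Y x : ℂ) : ℂ := (2/x)*(-2*(x+1)^2*Y-(1+Y-(x+1)^2)*(1+Y))/DD Y x
noncomputable def Gf (Y x k : ℂ) : ℂ :=
  (k-x)*(p0 Y x + p1 Y x*(k^2-k))/((k^2+Y)*(k-1-x))

noncomputable def st (Y x k : ℂ) : ℂ :=
  (((k+2)^2+Y)*((k+1)^2-x^2)) / (((k+2)^2-x^2)*((k+1)^2+Y))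

lemma core0 (Y x k : ℂ) (hx : x ≠ 0) (hD : DD Y x ≠ 0)
    (h1 : k-1-x ≠ 0) (h2 : k+2+x ≠ 0) (h3 : k+2-x ≠ 0) (h4 : k+1-x ≠ 0)
    (h5 : k^2+Y ≠ 0) (h6 : (k+1)^2+Y ≠ 0) (h7 : (k+2)^2+Y ≠ 0) :
    st Y x k * Gf Y x (k+2) - Gf Y x k =
      (2/x)*(2*k+1)*(k^2+k+1+Y)/((k-1-x)*(k+2+x)*(k^2+Y)*((k+1)^2+Y)) := by
  have e1 : (k+2)^2-x^2 = (k+2-x)*(k+2+x) := by ring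
  have e2 : (k+1)^2-x^2 = (k+1-x)*(k+1+x) := by ring
  have e3 : k+2-1-x = k+1-x := by ring
  have a1 : st Y x k * Gf Y x (k+2) =
      (k+1+x)*(p0 Y x + p1 Y x*((k+2)^2-(k+2)))/((k+2+x)*((k+1)^2+Y)) := by
    unfold st Gf
    rw [e1, e2, e3]
    field_simp
  rw [a1]
  unfold Gf
  have key : (k+1+x)*(k-1-x)*(k^2+Y)*(p0 Y x + p1 Y x*((k+2)^2-(k+2)))
      - (k-x)*(k+2+x)*((k+1)^2+Y)*(p0 Y x + p1 Y x*(k^2-k)) =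
      (2/x)*(2*k+1)*(k^2+k+1+Y) := by
    have q1 : p1 Y x * DD Y x = -(2/x)*(1+Y+(x+1)^2) := by
      unfold p1; field_simp
    have q0 : p0 Y x * DD Y x = (2/x)*(-2*(x+1)^2*Y-(1+Y-(x+1)^2)*(1+Y)) := by
      unfold p0; field_simp
    apply mul_right_cancel₀ hD
    have : ((k+1+x)*(k-1-x)*(k^2+Y)*(p0 Y x + p1 Y x*((k+2)^2-(k+2)))
      - (k-x)*(k+2+x)*((k+1)^2+Y)*(p0 Y x + p1 Y x*(k^2-k))) * DD Y x =
      (k+1+x)*(k-1-x)*(k^2+Y)*(p0 Y x * DD Y x + p1 Y x* DD Y x*((k+2)^2-(k+2)))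
      - (k-x)*(k+2+x)*((k+1)^2+Y)*(p0 Y x* DD Y x + p1 Y x* DD Y x*(k^2-k)) := by ring
    rw [this, q1, q0]
    unfold DD
    ring
  rw [← key]
  field_simp
  

lemma core1 (Y x k : ℂ) (hx : x ≠ 0) 
    (h1 : k-1-x ≠ 0) (h2 : k+2+x ≠ 0) (hk : k ≠ 0) (hk1 : k+1 ≠ 0)
    (h5 : k^2+Y ≠ 0) (h6 : (k+1)^2+Y ≠ 0) :
    (RR x k - 1) * wt Y k =
      (2/x)*(2*k+1)*(k^2+k+1+Y)/((k-1-x)*(k+2+x)*(k^2+Y)*((k+1)^2+Y)) := by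
  have : RR x k - 1 = 2*(k*(k+1))/(x*((k-1-x)*(k+2+x))) := by
    unfold RR
    field_simp
    ring
  rw [this]
  unfold wt
  field_simp
  ring

def NI (x : ℂ) : Prop := ∀ n : ℤ, x ≠ n
def HY (Y : ℂ) : Prop := ∀ n : ℤ, (n:ℂ)^2+Y ≠ 0

lemma NI.add {x : ℂ} (h : NI x) (n : ℤ) : x + n ≠ 0 := fun e => h (-n) (by
  push_cast; linear_combination e)
lemma NI.sub {x : ℂ} (h : NI x) (n : ℤ) : (n:ℂ) - x ≠ 0 := fun e => h n (by
  linear_combination -e)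
lemma NI.sq {x : ℂ} (h : NI x) (n : ℤ) : (n:ℂ)^2 - x^2 ≠ 0 := by
  have := mul_ne_zero (h.add n) (h.sub n)
  intro e; apply this; linear_combination e
lemma NI.shift {x : ℂ} (h : NI x) (n : ℤ) : NI (x+n) := fun k e => h (k-n) (by
  push_cast; linear_combination e)
lemma NI.neg {x : ℂ} (h : NI x) : NI (-x) := fun k e => h (-k) (by
  push_cast; linear_combination -e)
lemma NI.ne {x : ℂ} (h : NI x) : x ≠ 0 := by simpa using h 0

lemma eP_succ (Y x : ℂ) (m : ℕ) : eP Y x (m+1) = eP Y x m * st Y x ((2*m:ℕ):ℂ) := by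
  unfold eP st
  rw [prod_range_succ]
  push_cast
  rfl

lemma eN_succ (Y x : ℂ) (hY : HY Y) (hx : NI x) (n : ℕ) :
    eN Y x (n+1) * st Y x (-((2*n+2:ℕ):ℂ)) = eN Y x n := by
  unfold eN st
  rw [prod_range_succ]
  have a1 := hx.sq (2*n); have a2 := hx.sq (2*n+1)
  have a3 := hY (2*n); have a4 := hY (2*n+1)
  push_cast at *
  have e1 : (-(2*(n:ℂ)+2)+2)^2 = (2*n)^2 := by ring
  have e2 : (-(2*(n:ℂ)+2)+1)^2 = (2*n+1)^2 := by ring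
  rw [e1, e2, mul_assoc, div_mul_div_cancel₀ (mul_ne_zero a3 a2),
    div_self (mul_ne_zero a1 a4), mul_one]

lemma st_shift (Y x k : ℂ) (hx : x ≠ 0) (h1 : k-1-x ≠ 0) (h2 : k+2+x ≠ 0) (h3 : k-x ≠ 0)
    (h4 : k+4+x ≠ 0) (h5 : k+2-x ≠ 0) (h6 : k+1-x ≠ 0) (h7 : (k+1)^2+Y ≠ 0) :
    RR x k * st Y (x+2) k = st Y x k * RR x (k+2) := by
  unfold RR st
  have e1 : (k+2)^2-(x+2)^2 = (k-x)*(k+4+x) := by ring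
  have e2 : (k+1)^2-(x+2)^2 = (k-1-x)*(k+3+x) := by ring
  have e3 : (k+2)^2-x^2 = (k+2-x)*(k+2+x) := by ring
  have e4 : (k+1)^2-x^2 = (k+1-x)*(k+1+x) := by ring
  have e5 : k+2-1-x = k+1-x := by ring
  have e6 : k+2+2+x = k+4+x := by ring
  have e7 : k+2+1+x = k+3+x := by ring
  rw [e1,e2,e3,e4,e5,e6,e7]
  field_simp

lemma eP_shift (Y x : ℂ) (hY : HY Y) (hx : NI x) (m : ℕ) :
    eP Y (x+2) m = eP Y x m * RR x ((2*m:ℕ):ℂ) := by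
  induction m with
  | zero =>
    have a1 := hx.ne
    have a2 := hx.add 1
    have a3 := hx.add 2
    have a4 : -1-x ≠ 0 := by have := hx.sub (-1); push_cast at this; exact this
    push_cast at a2 a3
    simp [eP, RR]
    rw [eq_comm, div_eq_one_iff_eq]
    · ring
    · refine mul_ne_zero (mul_ne_zero a1 a4) (by rwa [add_comm])
  | succ m ih =>
    have b2 := hx.sub (2*m-1); have b3 := hx.add (2*m+2); have b4 := hx.add (2*m+4)
    have b5 := hx.sub (2*m); have b6 := hx.sub (2*m+2); have b7 := hx.sub (2*m+1)
    have a4 := hY (2*m+1)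
    have := st_shift Y x ((2*m:ℕ):ℂ) hx.ne (by convert b2 using 1; push_cast; ring)
      (by convert b3 using 1; push_cast; ring) (by convert b5 using 1; push_cast; ring)
      (by convert b4 using 1; push_cast; ring) (by convert b6 using 1; push_cast; ring)
      (by convert b7 using 1; push_cast; ring) (by convert a4 using 1; push_cast; ring)
    rw [eP_succ, eP_succ, ih, mul_assoc, mul_assoc, this]
    congr 3
    push_cast; ring

lemma eN_shift (Y x : ℂ) (hY : HY Y) (hx : NI x) (n : ℕ) :
    eN Y (x+2) n = eN Y x n * RR x (-((2*n:ℕ):ℂ)) := by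
  induction n with
  | zero =>
    have := eP_shift Y x hY hx 0
    simpa [eP, eN] using this
  | succ n ih =>
    have c1 := eN_succ Y x hY hx n
    have c2 := eN_succ Y (x+2) hY (by simpa using hx.shift 2) n
    rw [ih, ← c1] at c2
    have b1 := hx.ne
    have b2 := hx.add (2*n+2); have b3 := hx.add (2*n+1); have b4 := hx.add (2*n+3)
    have b5 := hx.sub (2*n); have b6 := hx.sub (2*n+1); have b7 := hx.sub (2*n-1)
    have b8 := hx.add (2*n); have b9 := hx.sub (2*n-2)
    have a4 := hY (2*n+1)
    have a5 := hY (2*n)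
    have hst : st Y (x+2) (-((2*n+2:ℕ):ℂ)) ≠ 0 := by
      unfold st
      push_cast at *
      have e1 : (-(2*(n:ℂ)+2)+2)^2 = (2*n)^2 := by ring
      have e2 : (-(2*(n:ℂ)+2)+1)^2 = (2*n+1)^2 := by ring
      rw [e1, e2]
      have e3 : (2*(n:ℂ)+1)^2-(x+2)^2 = (2*n-1-x)*(x+(2*n+3)) := by ring
      have e4 : (2*(n:ℂ))^2-(x+2)^2 = (2*n-2-x)*(x+(2*n+2)) := by ring
      rw [e3, e4]
      refine div_ne_zero (mul_ne_zero a5 (mul_ne_zero b7 b4)) (mul_ne_zero (mul_ne_zero b9 b2) a4)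
    have e00 : -((2*(n+1):ℕ):ℂ) = -((2*n+2:ℕ):ℂ) := by push_cast; ring
    have := st_shift Y x (-((2*n+2:ℕ):ℂ)) hx.ne
      (by rw [← neg_ne_zero]; convert b4 using 1; push_cast; ring)
      (by rw [← neg_ne_zero]; convert b5 using 1; push_cast; ring)
      (by rw [← neg_ne_zero]; convert b2 using 1; push_cast; ring)
      (by rw [← neg_ne_zero]; convert b9 using 1; push_cast; ring)
      (by rw [← neg_ne_zero]; convert b8 using 1; push_cast; ring)
      (by rw [← neg_ne_zero]; convert b3 using 1; push_cast; ring)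
      (by convert a4 using 1; push_cast; ring)
    apply mul_right_cancel₀ hst
    rw [c2, mul_assoc, mul_assoc, e00, this]
    congr 3
    push_cast; ring

noncomputable def tt (x : ℂ) : ℂ := 2/(x*(x+1)*(x+2))

lemma FP_diff_succ (Y x : ℂ) (hY : HY Y) (hx : NI x) (hD : DD Y x ≠ 0) (m : ℕ) :
    FP Y (x+2) (m+1) - FP Y x (m+1) =
      eP Y x (m+2) * Gf Y x ((2*(m+2):ℕ):ℂ) - eP Y x (m+1) * Gf Y x ((2*(m+1):ℕ):ℂ) := by
  unfold FP
  rw [eP_shift Y x hY hx, eP_succ Y x (m+1)]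
  have b1 := hx.sub (2*m+1); have b2 := hx.add (2*m+4); have b3 := hx.sub (2*m+4)
  have b4 := hx.sub (2*m+3)
  have a1 := hY (2*m+2); have a2 := hY (2*m+3); have a3 := hY (2*m+4)
  have hk : ((2*(m+1):ℕ):ℂ) ≠ 0 := by exact_mod_cast (by omega : 2*(m+1) ≠ 0)
  have hk1 : ((2*(m+1):ℕ):ℂ) + 1 ≠ 0 := by exact_mod_cast (by omega : 2*(m+1) + 1 ≠ 0)
  set k : ℂ := ((2*(m+1):ℕ):ℂ) with hkdef
  have hk' : k = 2*m+2 := by rw [hkdef]; push_cast; ring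
  have e0 : ((2*(m+2):ℕ):ℂ) = k+2 := by rw [hk']; push_cast; ring
  push_cast at b1 b2 b3 b4 a1 a2 a3
  have h1 : k-1-x ≠ 0 := by convert b1 using 1; rw [hk']; ring
  have h2 : k+2+x ≠ 0 := by convert b2 using 1; rw [hk']; ring
  have h3 : k+2-x ≠ 0 := by convert b3 using 1; rw [hk']; ring
  have h4 : k+1-x ≠ 0 := by convert b4 using 1; rw [hk']; ring
  have h5 : k^2+Y ≠ 0 := by convert a1 using 1; rw [hk']
  have h6 : (k+1)^2+Y ≠ 0 := by convert a2 using 1; rw [hk']; ring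
  have h7 : (k+2)^2+Y ≠ 0 := by convert a3 using 1; rw [hk']; ring
  have := core1 Y x k hx.ne h1 h2 hk hk1 h5 h6
  rw [← core0 Y x k hx.ne hD h1 h2 h3 h4 h5 h6 h7] at this
  rw [e0]
  linear_combination eP Y x (m+1) * this

lemma FN_diff (Y x : ℂ) (hY : HY Y) (hx : NI x) (hD : DD Y x ≠ 0) (n : ℕ) :
    FN Y (x+2) n - FN Y x n =
      eN Y x n * Gf Y x (-((2*n:ℕ):ℂ)) - eN Y x (n+1) * Gf Y x (-((2*(n+1):ℕ):ℂ)) := by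
  unfold FN
  rw [eN_shift Y x hY hx, ← eN_succ Y x hY hx n]
  have b1 := hx.add (2*n+3); have b2 := hx.sub (2*n); have b3 := hx.add (2*n)
  have b4 := hx.add (2*n+1)
  have a1 := hY (2*n+2); have a2 := hY (2*n+1); have a3 := hY (2*n)
  have hk : -((2*(n+1):ℕ):ℂ) ≠ 0 := by
    rw [neg_ne_zero]; exact_mod_cast (by omega : 2*(n+1) ≠ 0)
  have hk1 : -((2*(n+1):ℕ):ℂ) + 1 ≠ 0 := by
    have : ((2*n+1:ℕ):ℂ) ≠ 0 := by exact_mod_cast (by omega : 2*n+1 ≠ 0)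
    rw [← neg_ne_zero]; convert this using 1; push_cast; ring
  have e00 : 2*n+2 = 2*(n+1) := by ring
  rw [e00]
  set k : ℂ := -((2*(n+1):ℕ):ℂ) with hkdef
  have hk' : k = -(2*n+2) := by rw [hkdef]; push_cast; ring
  have e0 : -((2*n:ℕ):ℂ) = k+2 := by rw [hk']; push_cast; ring
  push_cast at b1 b2 b3 b4 a1 a2 a3
  have h1 : k-1-x ≠ 0 := by rw [← neg_ne_zero]; convert b1 using 1; rw [hk']; ring
  have h2 : k+2+x ≠ 0 := by rw [← neg_ne_zero]; convert b2 using 1; rw [hk']; ring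
  have h3 : k+2-x ≠ 0 := by rw [← neg_ne_zero]; convert b3 using 1; rw [hk']; ring
  have h4 : k+1-x ≠ 0 := by rw [← neg_ne_zero]; convert b4 using 1; rw [hk']; ring
  have h5 : k^2+Y ≠ 0 := by convert a1 using 1; rw [hk']; ring
  have h6 : (k+1)^2+Y ≠ 0 := by convert a2 using 1; rw [hk']; ring
  have h7 : (k+2)^2+Y ≠ 0 := by convert a3 using 1; rw [hk']; ring
  have := core1 Y x k hx.ne h1 h2 hk hk1 h5 h6
  rw [← core0 Y x k hx.ne hD h1 h2 h3 h4 h5 h6 h7] at this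
  rw [e0]
  linear_combination eN Y x (n+1) * this

lemma FP_diff_zero (Y x : ℂ) (hY : HY Y) (hx : NI x) (hD : DD Y x ≠ 0) :
    FP Y (x+2) 0 - FP Y x 0 =
      eP Y x 1 * Gf Y x ((2:ℕ):ℂ) - Gf Y x 0 + tt x / Y := by
  have h0 : eP Y x 1 = st Y x 0 := by
    rw [eP_succ Y x 0]; simp [eP]
  rw [h0]
  have b1 := hx.add 1; have b2 := hx.add 2; have b3 := hx.sub 2
  have b4 := hx.sub 1
  have a1 := hY 0; have a2 := hY 1; have a3 := hY 2
  have b0 := hx.ne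
  push_cast at *
  have := core0 Y x 0 hx.ne hD (by rw [← neg_ne_zero]; convert b1 using 1; ring)
    (by convert b2 using 1; ring) (by simpa using b3) (by simpa using b4) a1
    (by simpa using a2) (by simpa using a3)
  have e : FP Y (x+2) 0 - FP Y x 0 = 0 := by simp [FP, eP]
  simp only [zero_add] at this
  rw [e, this]
  unfold tt
  have a1' : Y ≠ 0 := by simpa using a1
  have a2' : 1 + Y ≠ 0 := by simpa using a2
  have c1 : (0:ℂ)-1-x = -(x+1) := by ring
  have c2 : (2:ℂ)+x = x+2 := by ring
  rw [c1, c2]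
  field_simp
  ring

end ZS
end

section
open Filter Topology Finset
namespace ZS

lemma norm_le_add_one {t : ℂ} (h : -(1/2) ≤ t.re) : ‖t‖ ≤ ‖t+1‖ := by
  rw [← abs_of_nonneg (norm_nonneg t), ← abs_of_nonneg (norm_nonneg (t+1)), ← sq_le_sq,
    Complex.sq_norm, Complex.sq_norm, Complex.normSq_apply, Complex.normSq_apply]
  simp; nlinarith

lemma fac_le {t : ℂ} (h : 1 < t.re) :
    ‖t+1‖^2/‖t‖^2 ≤ (t.re+1)/(t.re-1) := by
  have h0 : 0 < ‖t‖^2 := by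
    rw [Complex.sq_norm, Complex.normSq_apply]; nlinarith [mul_self_nonneg t.im]
  rw [div_le_div_iff₀ h0 (by linarith)]
  rw [Complex.sq_norm, Complex.sq_norm, Complex.normSq_apply, Complex.normSq_apply]
  simp; nlinarith [mul_self_nonneg t.im]

noncomputable def LL (t : ℂ) (m : ℕ) : ℝ :=
  ∏ j ∈ range m, ‖2*(j:ℂ)+1-t‖^2/‖2*(j:ℂ)+2-t‖^2

lemma LL_nonneg (t : ℂ) (m : ℕ) : 0 ≤ LL t m := prod_nonneg (fun _ _ => by positivity)

lemma LL_bound (σ : ℂ) (h1 : -(1/2) ≤ σ.re) (h2 : σ.re ≤ 3/2) :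
    ∃ C : ℝ, 0 < C ∧ ∀ K m : ℕ, LL (σ+2*K) m ≤ C*(4*m+1) := by
  have c1 : ∀ K m : ℕ, m+1 ≤ K → LL (σ+2*K) m ≤ (2*K+σ.re-1)/(2*((K:ℝ)-m)+σ.re-1) := by
    intro K m
    induction m with
    | zero =>
      intro h
      have : (1:ℝ) ≤ K := by exact_mod_cast h
      simp only [LL, range_zero, prod_empty, Nat.cast_zero, sub_zero]
      rw [div_self]; linarith
    | succ m ih =>
      intro h
      have h' : (m:ℝ)+2 ≤ K := by exact_mod_cast h
      have ih := ih (by omega)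
      have e : LL (σ+2*K) (m+1) = LL (σ+2*K) m *
        (‖(σ+2*K-2*m-2)+1‖^2/‖σ+2*K-2*m-2‖^2) := by
        unfold LL
        rw [prod_range_succ, ← norm_neg (2*(m:ℂ)+1-(σ+2*K)), ← norm_neg (2*(m:ℂ)+2-(σ+2*K))]
        congr 5 <;> ring
      have re : (σ+2*K-2*m-2).re = σ.re+2*K-2*m-2 := by simp
      have f := fac_le (t := σ+2*K-2*m-2) (by rw [re]; linarith)
      rw [re] at f
      rw [e]
      calc _ ≤ (2*K+σ.re-1)/(2*((K:ℝ)-m)+σ.re-1) * ((σ.re+2*K-2*m-2+1)/(σ.re+2*K-2*m-2-1)) := by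
            apply mul_le_mul ih f (by positivity)
            apply div_nonneg <;> linarith
        _ = _ := by
            push_cast
            have : 2*((K:ℝ)-m)+σ.re-1 ≠ 0 := by intro hh; linarith
            have e1 : σ.re+2*K-2*m-2+1 = 2*((K:ℝ)-m)+σ.re-1 := by ring
            have e2 : σ.re+2*K-2*m-2-1 = 2*((K:ℝ)-(m+1))+σ.re-1 := by ring
            rw [e1, e2, div_mul_div_cancel₀ this]
  have c2 : ∀ K m : ℕ, m+1 ≤ K → LL (σ+2*K) m ≤ 4*m+1 := by
    intro K m h
    refine (c1 K m h).trans ?_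
    have h' : (m:ℝ)+1 ≤ K := by exact_mod_cast h
    rw [div_le_iff₀ (by linarith)]
    have : (0:ℝ) ≤ m := by positivity
    nlinarith
  refine ⟨1+‖1+σ‖^2/‖σ‖^2, by positivity, ?_⟩
  intro K m
  have hq : 0 ≤ ‖1+σ‖^2/‖σ‖^2 := by positivity
  rcases lt_or_ge m K with h | h
  · have : (0:ℝ) ≤ m := by positivity
    nlinarith [c2 K m h]
  · induction m, h using Nat.le_induction with
    | base =>
      rcases K with _ | K
      · simp [LL]; positivity
      · have := c2 (K+1) K le_rfl
        have e : LL (σ+2*(K+1:ℕ)) (K+1) = LL (σ+2*(K+1:ℕ)) K * (‖1+σ‖^2/‖σ‖^2) := by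
          conv_lhs => unfold LL
          rw [prod_range_succ, ← norm_neg (1+σ), ← norm_neg (σ)]
          unfold LL
          congr 5 <;> (push_cast; ring)
        rw [e]
        have h0 : (0:ℝ) ≤ K := by positivity
        calc _ ≤ (4*(K:ℝ)+1) * (‖1+σ‖^2/‖σ‖^2) := by gcongr
          _ ≤ _ := by push_cast; nlinarith
    | succ m hm ih =>
      have hm' : (K:ℝ) ≤ m := by exact_mod_cast hm
      have e : LL (σ+2*K) (m+1) ≤ LL (σ+2*K) m := by
        unfold LL
        rw [prod_range_succ]
        apply mul_le_of_le_one_right (LL_nonneg _ _)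
        apply div_le_one_of_le₀ _ (by positivity)
        gcongr
        have := norm_le_add_one (t := 2*(m:ℂ)+1-(σ+2*K)) (by simp; linarith)
        have e : 2*(m:ℂ)+2-(σ+2*K) = 2*(m:ℂ)+1-(σ+2*K)+1 := by ring
        rw [e]; exact this
      refine e.trans (ih.trans ?_)
      push_cast
      gcongr
      linarith

lemma YP_bound (Y : ℝ) (hY : 0 < Y) (m : ℕ) :
    ∏ j ∈ range m, ((2*(j:ℝ)+2)^2+Y)/((2*(j:ℝ)+1)^2+Y) ≤ 4*(m:ℝ)+1 := by
  induction m with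
  | zero => simp
  | succ m ih =>
    rw [prod_range_succ]
    calc _ ≤ (4*(m:ℝ)+1) * (((2*(m:ℝ)+2)^2+Y)/((2*(m:ℝ)+1)^2+Y)) := by gcongr
      _ ≤ _ := by
        rw [← mul_div_assoc, div_le_iff₀ (by positivity)]
        push_cast
        nlinarith

lemma YN_bound (Y : ℝ) (hY : 0 < Y) (hY1 : Y ≤ 1) (n : ℕ) :
    ∏ j ∈ range (n+1), ((2*(j:ℝ)+1)^2+Y)/((2*(j:ℝ))^2+Y) ≤ (2/Y)*(4*(n:ℝ)+3) := by
  induction n with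
  | zero =>
    simp
    rw [div_mul_eq_mul_div]
    gcongr; linarith
  | succ n ih =>
    rw [prod_range_succ]
    calc _ ≤ (2/Y)*(4*(n:ℝ)+3) * (((2*((n+1:ℕ):ℝ)+1)^2+Y)/((2*((n+1:ℕ):ℝ))^2+Y)) := by gcongr
      _ ≤ _ := by
        rw [mul_assoc]
        gcongr
        rw [← mul_div_assoc, div_le_iff₀ (by positivity)]
        push_cast
        have : (0:ℝ) ≤ n := by positivity
        nlinarith

noncomputable def bd (m : ℕ) : ℝ := √(((m:ℝ)+1)^3)/((m:ℝ)+1)^3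

lemma bd_nonneg (m : ℕ) : 0 ≤ bd m := by unfold bd; positivity

lemma bd_summable : Summable bd := by
  have h := (Real.summable_one_div_nat_rpow (p := 3/2)).2 (by norm_num)
  have h2 := (summable_nat_add_iff 1).2 h
  refine h2.congr (fun m => ?_)
  unfold bd
  have h0 : (0:ℝ) ≤ (m:ℝ)+1 := by positivity
  have h1 : (0:ℝ) < (m:ℝ)+1 := by positivity
  rw [Real.sqrt_eq_rpow, ← Real.rpow_natCast, ← Real.rpow_mul h0, ← Real.rpow_sub h1, one_div,
    Nat.cast_add, Nat.cast_one, ← Real.rpow_neg h0]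
  norm_num

end ZS
end

section
open Filter Topology Finset
namespace ZS

def good (s : ℂ) : Prop := NI s ∧ -(1/2) ≤ s.re ∧ s.re ≤ 1/2

lemma norm_cast_sq_add (Y : ℝ) (hY : 0 < Y) (a : ℝ) : ‖(a:ℂ)^2+(Y:ℂ)‖ = a^2+Y := by
  have : (a:ℂ)^2+(Y:ℂ) = ((a^2+Y : ℝ):ℂ) := by push_cast; ring
  rw [this, Complex.norm_real, Real.norm_of_nonneg (by positivity)]

lemma eP_norm_sq (Y : ℝ) (hY : 0 < Y) (x : ℂ) (hx : -(1/2) ≤ x.re) (m : ℕ) :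
    ‖eP Y x m‖^2 ≤ (4*(m:ℝ)+1)^2 * LL x m := by
  have h1 : ‖eP Y x m‖^2 ≤ (∏ j ∈ range m, ((2*(j:ℝ)+2)^2+Y)/((2*(j:ℝ)+1)^2+Y))^2 * LL x m := by
    unfold eP LL
    rw [norm_prod, ← prod_pow, ← prod_pow, ← prod_mul_distrib]
    apply prod_le_prod (fun _ _ => by positivity)
    intro j _
    have e1 : ((2*j+1:ℕ):ℂ)^2-x^2 = (2*(j:ℂ)+1-x)*(2*(j:ℂ)+1+x) := by push_cast; ring
    have e2 : ((2*j+2:ℕ):ℂ)^2-x^2 = (2*(j:ℂ)+2-x)*(2*(j:ℂ)+2+x) := by push_cast; ring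
    have n1 := norm_cast_sq_add Y hY (2*(j:ℝ)+2)
    have n2 := norm_cast_sq_add Y hY (2*(j:ℝ)+1)
    rw [e1, e2]
    push_cast at *
    rw [norm_div, norm_mul, norm_mul, norm_mul, norm_mul, n1, n2]
    have h : ‖2*(j:ℂ)+1+x‖/‖2*(j:ℂ)+2+x‖ ≤ 1 := by
      apply div_le_one_of_le₀ _ (by positivity)
      have := norm_le_add_one (t := 2*(j:ℂ)+1+x) (by simp; linarith [(Nat.cast_nonneg j : (0:ℝ) ≤ j)])
      have e : 2*(j:ℂ)+2+x = 2*(j:ℂ)+1+x+1 := by ring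
      rw [e]; exact this
    rw [← div_pow, ← mul_pow]
    apply pow_le_pow_left₀ (by positivity)
    calc _ = ((2*(j:ℝ)+2)^2+Y)/((2*(j:ℝ)+1)^2+Y) * (‖2*(j:ℂ)+1-x‖/‖2*(j:ℂ)+2-x‖) * 
          (‖2*(j:ℂ)+1+x‖/‖2*(j:ℂ)+2+x‖) := by
          simp only [div_eq_mul_inv, mul_inv]; ring
      _ ≤ _ := mul_le_of_le_one_right (by positivity) h
  refine h1.trans ?_
  gcongr
  · exact LL_nonneg _ _
  · exact YP_bound Y hY m

lemma eN_norm_sq (Y : ℝ) (hY : 0 < Y) (hY1 : Y ≤ 1) (x : ℂ) (hx : -(1/2) ≤ x.re) (n : ℕ) :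
    ‖eN Y x (n+1)‖^2 ≤ ((2/Y)*(4*(n:ℝ)+3))^2 * LL (x+1) (n+1) := by
  have h1 : ‖eN Y x (n+1)‖^2 ≤ (∏ j ∈ range (n+1), ((2*(j:ℝ)+1)^2+Y)/((2*(j:ℝ))^2+Y))^2 * LL (x+1) (n+1) := by
    unfold eN LL
    rw [norm_prod, ← prod_pow, ← prod_pow, ← prod_mul_distrib]
    apply prod_le_prod (fun _ _ => by positivity)
    intro j _
    have e1 : ((2*j+1:ℕ):ℂ)^2-x^2 = (2*(j:ℂ)+2-(x+1))*(2*(j:ℂ)+1+x) := by push_cast; ring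
    have e2 : ((2*j:ℕ):ℂ)^2-x^2 = (2*(j:ℂ)+1-(x+1))*(2*(j:ℂ)+x) := by push_cast; ring
    have n1 := norm_cast_sq_add Y hY (2*(j:ℝ))
    have n2 := norm_cast_sq_add Y hY (2*(j:ℝ)+1)
    rw [e1, e2]
    push_cast at *
    rw [norm_div, norm_mul, norm_mul, norm_mul, norm_mul, n1, n2]
    have h : ‖2*(j:ℂ)+x‖/‖2*(j:ℂ)+1+x‖ ≤ 1 := by
      apply div_le_one_of_le₀ _ (by positivity)
      have := norm_le_add_one (t := 2*(j:ℂ)+x) (by simp; linarith [(Nat.cast_nonneg j : (0:ℝ) ≤ j)])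
      have e : 2*(j:ℂ)+1+x = 2*(j:ℂ)+x+1 := by ring
      rw [e]; exact this
    rw [← div_pow, ← mul_pow]
    apply pow_le_pow_left₀ (by positivity)
    calc _ = ((2*(j:ℝ)+1)^2+Y)/((2*(j:ℝ))^2+Y) * (‖2*(j:ℂ)+1-(x+1)‖/‖2*(j:ℂ)+2-(x+1)‖) * 
          (‖2*(j:ℂ)+x‖/‖2*(j:ℂ)+1+x‖) := by
          simp only [div_eq_mul_inv, mul_inv]; ring
      _ ≤ _ := mul_le_of_le_one_right (by positivity) h
  refine h1.trans ?_
  gcongr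
  · exact LL_nonneg _ _
  · exact YN_bound Y hY hY1 n

lemma inv_cube_le (Y : ℝ) (hY : 0 < Y) (a : ℝ) (n : ℕ) (h : (n:ℝ)+1 ≤ |a|) :
    ‖1/((a:ℂ)*((a:ℂ)^2+Y))‖ ≤ 1/((n:ℝ)+1)^3 := by
  rw [norm_div, norm_mul, norm_cast_sq_add Y hY, Complex.norm_real, norm_one, Real.norm_eq_abs]
  apply one_div_le_one_div_of_le (by positivity)
  calc ((n:ℝ)+1)^3 ≤ |a|^3 := by gcongr
    _ = |a| * a^2 := by rw [← sq_abs a]; ring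
    _ ≤ _ := by gcongr; linarith

lemma wtP_bound (Y : ℝ) (hY : 0 < Y) (m : ℕ) : ‖wt Y ((2*m:ℕ):ℂ)‖ ≤ 2/((m:ℝ)+1)^3 := by
  unfold wt
  have h2 := inv_cube_le Y hY (2*m+1) m (by
    rw [abs_of_nonneg (by positivity)]; linarith [(Nat.cast_nonneg m : (0:ℝ) ≤ m)])
  have h1 : ‖1/(((2*m:ℕ):ℂ)*(((2*m:ℕ):ℂ)^2+Y))‖ ≤ 1/((m:ℝ)+1)^3 := by
    rcases Nat.eq_zero_or_pos m with h | h
    · subst h; simp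
    · have h' : (1:ℝ) ≤ m := by exact_mod_cast h
      have := inv_cube_le Y hY (2*m) m (by
        rw [abs_of_nonneg (by positivity)]; linarith)
      push_cast at *; exact this
  refine (norm_add_le _ _).trans ?_
  push_cast at *
  calc _ ≤ 1/((m:ℝ)+1)^3 + 1/((m:ℝ)+1)^3 := add_le_add h1 h2
    _ = _ := by ring

lemma wtN_bound (Y : ℝ) (hY : 0 < Y) (n : ℕ) : ‖wt Y (-((2*n+2:ℕ):ℂ))‖ ≤ 2/((n:ℝ)+1)^3 := by
  unfold wt
  have h0 : (0:ℝ) ≤ n := by positivity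
  have h2 := inv_cube_le Y hY (-(2*n+2)) n (by
    rw [abs_neg, abs_of_nonneg (by positivity)]; linarith)
  have h1 := inv_cube_le Y hY (-(2*n+2)+1) n (by
    rw [abs_of_nonpos (by linarith)]; linarith)
  refine (norm_add_le _ _).trans ?_
  push_cast at *
  calc _ ≤ 1/((n:ℝ)+1)^3 + 1/((n:ℝ)+1)^3 := add_le_add h2 h1
    _ = _ := by ring

lemma bd_of_sq {E W : ℂ} {D : ℝ} {m : ℕ} (hD : 0 ≤ D) (h : ‖E‖^2 ≤ D*((m:ℝ)+1)^3)
    (hW : ‖W‖ ≤ 2/((m:ℝ)+1)^3) : ‖E*W‖ ≤ (2*√D) * bd m := by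
  have : ‖E‖ ≤ √D * √(((m:ℝ)+1)^3) := by
    rw [← Real.sqrt_mul hD]; exact Real.le_sqrt_of_sq_le h
  rw [norm_mul]
  calc _ ≤ (√D * √(((m:ℝ)+1)^3)) * (2/((m:ℝ)+1)^3) := by gcongr
    _ = _ := by unfold bd; ring

lemma FP_bound (Y : ℝ) (hY : 0 < Y) (s : ℂ) (hs : good s) :
    ∃ C : ℝ, ∀ K m : ℕ, ‖FP Y (s+2*K) m‖ ≤ C * bd m := by
  obtain ⟨C, hC, h⟩ := LL_bound s hs.2.1 (by linarith [hs.2.2])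
  refine ⟨2*√(64*C), fun K m => ?_⟩
  unfold FP
  refine bd_of_sq (by positivity) ?_ (wtP_bound Y hY m)
  have hx : -(1/2) ≤ (s+2*(K:ℂ)).re := by
    simp; linarith [hs.2.1, (Nat.cast_nonneg K : (0:ℝ) ≤ K)]
  refine (eP_norm_sq Y hY _ hx m).trans ?_
  have h0 : (0:ℝ) ≤ m := by positivity
  have h4 : 4*(m:ℝ)+1 ≤ 4*(m+1) := by linarith
  calc _ ≤ (4*(m:ℝ)+1)^2 * (C*(4*m+1)) := by gcongr; exact h K m
    _ = C*(4*(m:ℝ)+1)^3 := by ring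
    _ ≤ C*(4*((m:ℝ)+1))^3 := by gcongr
    _ = _ := by ring

lemma FN_bound (Y : ℝ) (hY : 0 < Y) (hY1 : Y ≤ 1) (s : ℂ) (hs : good s) :
    ∃ C : ℝ, ∀ K m : ℕ, ‖FN Y (s+2*K) m‖ ≤ C * bd m := by
  obtain ⟨C, hC, h⟩ := LL_bound (s+1) (by simp; linarith [hs.2.1]) (by simp; linarith [hs.2.2])
  refine ⟨2*√((2/Y)^2*125*C), fun K m => ?_⟩
  unfold FN
  refine bd_of_sq (by positivity) ?_ (wtN_bound Y hY m)
  have hx : -(1/2) ≤ (s+2*(K:ℂ)).re := by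
    simp; linarith [hs.2.1, (Nat.cast_nonneg K : (0:ℝ) ≤ K)]
  refine (eN_norm_sq Y hY hY1 _ hx m).trans ?_
  have h0 : (0:ℝ) ≤ m := by positivity
  have e : s+2*(K:ℂ)+1 = s+1+2*K := by ring
  rw [e]
  have h2 := h K (m+1)
  push_cast at h2
  have h4 : 4*(m:ℝ)+3 ≤ 5*(m+1) := by linarith
  have h5 : 4*((m:ℝ)+1)+1 ≤ 5*(m+1) := by linarith
  calc _ ≤ ((2/Y)*(5*((m:ℝ)+1)))^2 * (C*(5*((m:ℝ)+1))) := by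
          gcongr
          · exact LL_nonneg _ _
          · exact h2.trans (by gcongr)
    _ = _ := by ring

lemma ratio_tendsto (a b : ℂ) (f : ℕ → ℂ) (hf : Tendsto (fun K => ‖f K‖) atTop atTop) :
    Tendsto (fun K => (a - (f K)^2)/(b-(f K)^2)) atTop (𝓝 1) := by
  have h1 : Tendsto (fun K => ((f K)^2)⁻¹) atTop (𝓝 0) := by
    apply tendsto_inv₀_cobounded.comp
    rw [← tendsto_norm_atTop_iff_cobounded]
    simp only [norm_pow]
    exact (tendsto_pow_atTop (by norm_num)).comp hf
  have h2 : Tendsto (fun K => (a*((f K)^2)⁻¹ - 1)/(b*((f K)^2)⁻¹-1)) atTop (𝓝 ((a*0-1)/(b*0-1))) := by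
    apply Tendsto.div
    · exact (h1.const_mul a).sub_const 1
    · exact (h1.const_mul b).sub_const 1
    · simp
  have e : (a*0-1)/(b*0-1) = (1:ℂ) := by simp
  rw [e] at h2
  refine h2.congr' ?_
  filter_upwards [hf.eventually_gt_atTop 0] with K hK
  have : f K ≠ 0 := by simpa using hK
  field_simp

lemma norm_shift_tendsto (s : ℂ) : Tendsto (fun K : ℕ => ‖s+2*(K:ℂ)‖) atTop atTop := by
  have h : Tendsto (fun K : ℕ => (K:ℝ) + (-‖s‖)) atTop atTop :=
    tendsto_atTop_add_const_right _ _ tendsto_natCast_atTop_atTop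
  refine tendsto_atTop_mono (fun K => ?_) h
  have h2 : ‖2*(K:ℂ)‖ = 2*K := by simp
  have h3 := norm_sub_le (s+2*(K:ℂ)) s
  have h4 : s+2*(K:ℂ)-s = 2*(K:ℂ) := by ring
  rw [h4, h2] at h3
  linarith [(Nat.cast_nonneg K : (0:ℝ) ≤ K)]

noncomputable def eP8 (Y : ℂ) (m : ℕ) : ℂ :=
  ∏ j ∈ range m, (((2*j+2 : ℕ):ℂ)^2+Y)/(((2*j+1 : ℕ):ℂ)^2+Y)
noncomputable def eN8 (Y : ℂ) (m : ℕ) : ℂ :=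
  ∏ j ∈ range m, (((2*j+1 : ℕ):ℂ)^2+Y)/(((2*j : ℕ):ℂ)^2+Y)

lemma eP_tendsto8 (Y s : ℂ) (m : ℕ) :
    Tendsto (fun K : ℕ => eP Y (s+2*K) m) atTop (𝓝 (eP8 Y m)) := by
  unfold eP eP8
  apply tendsto_finsetProd
  intro j _
  have := (ratio_tendsto (((2*j+1 : ℕ):ℂ)^2) (((2*j+2 : ℕ):ℂ)^2) _ (norm_shift_tendsto s)).const_mul
    ((((2*j+2 : ℕ):ℂ)^2+Y)/(((2*j+1 : ℕ):ℂ)^2+Y))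
  rw [mul_one] at this
  refine this.congr (fun K => ?_)
  simp only [div_eq_mul_inv, mul_inv]; ring

lemma eN_tendsto8 (Y s : ℂ) (m : ℕ) :
    Tendsto (fun K : ℕ => eN Y (s+2*K) m) atTop (𝓝 (eN8 Y m)) := by
  unfold eN eN8
  apply tendsto_finsetProd
  intro j _
  have := (ratio_tendsto (((2*j : ℕ):ℂ)^2) (((2*j+1 : ℕ):ℂ)^2) _ (norm_shift_tendsto s)).const_mul
    ((((2*j+1 : ℕ):ℂ)^2+Y)/(((2*j : ℕ):ℂ)^2+Y))
  rw [mul_one] at this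
  refine this.congr (fun K => ?_)
  simp only [div_eq_mul_inv, mul_inv]; ring

noncomputable def SS (Y x : ℂ) : ℂ := ∑' m, FP Y x m + ∑' m, FN Y x m
noncomputable def S8 (Y : ℂ) : ℂ :=
  ∑' m, eP8 Y m * wt Y ((2*m : ℕ):ℂ) + ∑' n, eN8 Y (n+1) * wt Y (-((2*n+2 : ℕ):ℂ))

lemma FP_summable (Y : ℝ) (hY : 0 < Y) (s : ℂ) (hs : good s) (K : ℕ) :
    Summable (FP Y (s+2*K)) := by
  obtain ⟨C, h⟩ := FP_bound Y hY s hs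
  exact Summable.of_norm_bounded (bd_summable.mul_left C) (fun m => h K m)

lemma FN_summable (Y : ℝ) (hY : 0 < Y) (hY1 : Y ≤ 1) (s : ℂ) (hs : good s) (K : ℕ) :
    Summable (FN Y (s+2*K)) := by
  obtain ⟨C, h⟩ := FN_bound Y hY hY1 s hs
  exact Summable.of_norm_bounded (bd_summable.mul_left C) (fun m => h K m)

lemma SS_tendsto8 (Y : ℝ) (hY : 0 < Y) (hY1 : Y ≤ 1) (s : ℂ) (hs : good s) :
    Tendsto (fun K : ℕ => SS Y (s+2*K)) atTop (𝓝 (S8 Y)) := by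
  obtain ⟨C, h⟩ := FP_bound Y hY s hs
  obtain ⟨C', h'⟩ := FN_bound Y hY hY1 s hs
  unfold SS S8
  apply Tendsto.add
  · apply tendsto_tsum_of_dominated_convergence (bd_summable.mul_left C)
    · intro m
      exact (eP_tendsto8 Y s m).mul_const _
    · exact Eventually.of_forall (fun K m => h K m)
  · apply tendsto_tsum_of_dominated_convergence (bd_summable.mul_left C')
    · intro m
      exact (eN_tendsto8 Y s (m+1)).mul_const _
    · exact Eventually.of_forall (fun K m => h' K m)

end ZS
end

section
open Filter Topology Finset
namespace ZS

lemma Gf_tendsto (Y x : ℂ) (f : ℕ → ℂ) (h0 : ∀ᶠ m in atTop, f m ≠ 0)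
    (hf : Tendsto (fun m => (f m)⁻¹) atTop (𝓝 0)) :
    Tendsto (fun m => Gf Y x (f m)) atTop (𝓝 (p1 Y x)) := by
  have hc : ContinuousAt (fun u : ℂ => (1-x*u)*(p0 Y x*u^2+p1 Y x*(1-u))/((1+Y*u^2)*(1-u-x*u))) 0 := by
    apply ContinuousAt.div
    · fun_prop
    · fun_prop
    · simp
  have h := hc.tendsto.comp hf
  simp only [mul_zero, sub_zero, one_mul, ne_eq, OfNat.ofNat_ne_zero, not_false_eq_true, zero_pow, zero_add,
    mul_one, add_zero, div_one] at h
  refine h.congr' ?_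
  filter_upwards [h0] with m hm
  unfold Gf
  simp only [Function.comp_apply]
  generalize p0 Y x = a
  generalize p1 Y x = b
  have e1 : f m - x = f m * (1-x*(f m)⁻¹) := by field_simp
  have e2 : a + b*((f m)^2-f m) = (f m)^2 * (a*((f m)⁻¹)^2+b*(1-(f m)⁻¹)) := by field_simp
  have e3 : (f m)^2+Y = (f m)^2*(1+Y*((f m)⁻¹)^2) := by field_simp
  have e4 : f m - 1 - x = f m * (1-(f m)⁻¹-x*(f m)⁻¹) := by field_simp
  rw [e1,e2,e3,e4]
  rw [show f m * (1-x*(f m)⁻¹) * ((f m)^2 * (a*((f m)⁻¹)^2+b*(1-(f m)⁻¹))) =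
    (f m)^3 * ((1-x*(f m)⁻¹)*(a*((f m)⁻¹)^2+b*(1-(f m)⁻¹))) by ring,
    show (f m)^2*(1+Y*((f m)⁻¹)^2) * (f m * (1-(f m)⁻¹-x*(f m)⁻¹)) =
    (f m)^3 * ((1+Y*((f m)⁻¹)^2)*(1-(f m)⁻¹-x*(f m)⁻¹)) by ring,
    mul_div_mul_left _ _ (pow_ne_zero 3 hm)]

lemma RR_tendsto (x : ℂ) (hx : x ≠ 0) (f : ℕ → ℂ) (h0 : ∀ᶠ m in atTop, f m ≠ 0)
    (hf : Tendsto (fun m => (f m)⁻¹) atTop (𝓝 0)) :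
    Tendsto (fun m => RR x (f m)) atTop (𝓝 ((x+2)/x)) := by
  have hc : ContinuousAt (fun u : ℂ => (x+2)*(1+u+x*u)*(1-x*u)/(x*(1-u-x*u)*(1+2*u+x*u))) 0 := by
    apply ContinuousAt.div
    · fun_prop
    · fun_prop
    · simpa using hx
  have h := hc.tendsto.comp hf
  simp only [mul_zero, sub_zero, mul_one, add_zero] at h
  refine h.congr' ?_
  filter_upwards [h0] with m hm
  unfold RR
  simp only [Function.comp_apply]
  have e1 : f m + 1 + x = f m * (1+(f m)⁻¹+x*(f m)⁻¹) := by field_simp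
  have e2 : f m - x = f m * (1-x*(f m)⁻¹) := by field_simp
  have e3 : f m - 1 - x = f m * (1-(f m)⁻¹-x*(f m)⁻¹) := by field_simp
  have e4 : f m + 2 + x = f m * (1+2*(f m)⁻¹+x*(f m)⁻¹) := by field_simp
  rw [e1,e2,e3,e4]
  generalize (f m)⁻¹ = u
  rw [show (x+2)*(f m * (1+u+x*u)) * (f m * (1-x*u)) = (f m)^2 * ((x+2)*(1+u+x*u)*(1-x*u)) by ring,
    show x*(f m * (1-u-x*u)) * (f m * (1+2*u+x*u)) = (f m)^2 * (x*(1-u-x*u)*(1+2*u+x*u)) by ring,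
    mul_div_mul_left _ _ (pow_ne_zero 2 hm)]

lemma seqP_ne : ∀ᶠ m : ℕ in atTop, ((2*m:ℕ):ℂ) ≠ 0 := by
  filter_upwards [eventually_gt_atTop 0] with m hm
  exact_mod_cast (by omega : 2*m ≠ 0)
lemma seqN_ne : ∀ᶠ m : ℕ in atTop, -((2*m:ℕ):ℂ) ≠ 0 := by
  filter_upwards [seqP_ne] with m hm
  exact neg_ne_zero.2 hm
lemma seqP_inv : Tendsto (fun m : ℕ => (((2*m:ℕ):ℂ))⁻¹) atTop (𝓝 0) := by
  have h := tendsto_inv_atTop_nhds_zero_nat (𝕜 := ℂ)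
  exact h.comp (tendsto_id.const_mul_atTop' (by norm_num : 0 < 2))
lemma seqN_inv : Tendsto (fun m : ℕ => (-((2*m:ℕ):ℂ))⁻¹) atTop (𝓝 0) := by
  have := seqP_inv.neg
  simp only [neg_zero] at this
  refine this.congr (fun m => ?_)
  rw [inv_neg]

lemma SS_step (Y x Ep En : ℂ) (hY : HY Y) (hx : NI x) (hD : DD Y x ≠ 0)
    (s1 : Summable (FP Y x)) (s2 : Summable (FP Y (x+2))) 
    (s3 : Summable (FN Y x)) (s4 : Summable (FN Y (x+2))) 
    (hp : Tendsto (eP Y x) atTop (𝓝 Ep)) (hn : Tendsto (eN Y x) atTop (𝓝 En)) :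
    SS Y (x+2) - SS Y x = (Ep - En) * p1 Y x + tt x / Y := by
  have a1 : ∀ M, ∑ m ∈ range (M+1), (FP Y (x+2) m - FP Y x m) =
      eP Y x (M+1) * Gf Y x ((2*(M+1):ℕ):ℂ) - Gf Y x 0 + tt x / Y := by
    intro M
    induction M with
    | zero => simpa using FP_diff_zero Y x hY hx hD
    | succ M ih => rw [sum_range_succ, ih, FP_diff_succ Y x hY hx hD]; ring_nf
  have a2 : ∀ N, ∑ n ∈ range N, (FN Y (x+2) n - FN Y x n) =
      Gf Y x 0 - eN Y x N * Gf Y x (-((2*N:ℕ):ℂ)) := by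
    intro N
    induction N with
    | zero => simp [eN]
    | succ N ih => rw [sum_range_succ, ih, FN_diff Y x hY hx hD]; ring
  have t1 := ((s2.sub s1).hasSum.tendsto_sum_nat).comp (tendsto_add_atTop_nat 1)
  have t2 := (s4.sub s3).hasSum.tendsto_sum_nat
  have l1 := hp.mul (Gf_tendsto Y x _ seqP_ne seqP_inv)
  have l1' := ((l1.comp (tendsto_add_atTop_nat 1)).sub_const (Gf Y x 0)).add_const (tt x / Y)
  have l2 := (hn.mul (Gf_tendsto Y x _ seqN_ne seqN_inv)).const_sub (Gf Y x 0)
  have u1 := tendsto_nhds_unique (t1.congr (fun M => a1 M)) l1'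
  have u2 := tendsto_nhds_unique (t2.congr (fun M => a2 M)) l2
  rw [s2.tsum_sub s1] at u1
  rw [s4.tsum_sub s3] at u2
  unfold SS
  linear_combination u1 + u2

lemma eP_lim_shift (Y s E : ℂ) (hY : HY Y) (hs : NI s) (h : Tendsto (eP Y s) atTop (𝓝 E)) (K : ℕ) :
    Tendsto (eP Y (s+2*K)) atTop (𝓝 ((s+2*K)/s*E)) := by
  induction K with
  | zero => simpa [div_self hs.ne] using h
  | succ K ih =>
    have hx : NI (s+2*K) := by simpa using hs.shift (2*K)
    have := ih.mul (RR_tendsto (s+2*K) hx.ne _ seqP_ne seqP_inv)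
    have e : s+2*((K+1:ℕ):ℂ) = s+2*K+2 := by push_cast; ring
    rw [e]
    have e2 : (s+2*K)/s*E*((s+2*K+2)/(s+2*K)) = (s+2*K+2)/s*E := by
      have := hx.ne; have := hs.ne
      field_simp
    rw [e2] at this
    exact this.congr (fun m => (eP_shift Y _ hY hx m).symm)

lemma eN_lim_shift (Y s E : ℂ) (hY : HY Y) (hs : NI s) (h : Tendsto (eN Y s) atTop (𝓝 E)) (K : ℕ) :
    Tendsto (eN Y (s+2*K)) atTop (𝓝 ((s+2*K)/s*E)) := by
  induction K with
  | zero => simpa [div_self hs.ne] using h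
  | succ K ih =>
    have hx : NI (s+2*K) := by simpa using hs.shift (2*K)
    have := ih.mul (RR_tendsto (s+2*K) hx.ne _ seqN_ne seqN_inv)
    have e : s+2*((K+1:ℕ):ℂ) = s+2*K+2 := by push_cast; ring
    rw [e]
    have e2 : (s+2*K)/s*E*((s+2*K+2)/(s+2*K)) = (s+2*K+2)/s*E := by
      have := hx.ne; have := hs.ne
      field_simp
    rw [e2] at this
    exact this.congr (fun m => (eN_shift Y _ hY hx m).symm)

lemma HY_real (Y : ℝ) (hY : 0 < Y) : HY (Y:ℂ) := by
  intro n h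
  have : ((n^2+Y : ℝ):ℂ) = 0 := by push_cast; exact h
  have h2 : (n:ℝ)^2+Y = 0 := by exact_mod_cast this
  nlinarith [sq_nonneg (n:ℝ)]

lemma p1_eq (Y x : ℂ) (hD : DD Y x ≠ 0) :
    x * p1 Y x = -(1/(x^2+Y) + 1/((x+2)^2+Y)) ∨ x = 0 := by
  by_cases hx : x = 0
  · right; exact hx
  left
  unfold p1
  unfold DD at *
  have h1 := left_ne_zero_of_mul hD
  have h2 := right_ne_zero_of_mul hD
  field_simp
  ring

lemma SS_step' (Y : ℝ) (hY : 0 < Y) (hY1 : Y ≤ 1) (s Ep En : ℂ) (hs : good s) (K : ℕ)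
    (hD : DD Y (s+2*K) ≠ 0)
    (hp : Tendsto (eP Y s) atTop (𝓝 Ep)) (hn : Tendsto (eN Y s) atTop (𝓝 En)) :
    SS Y (s+2*(K+1:ℕ)) - SS Y (s+2*K) = 
      -((Ep-En)/s)*(1/((s+2*K)^2+Y) + 1/((s+2*(K+1:ℕ))^2+Y)) + tt (s+2*K) / Y := by
  have hH := HY_real Y hY
  have hx : NI (s+2*K) := by simpa using hs.1.shift (2*K)
  have e : s+2*((K+1:ℕ):ℂ) = s+2*K+2 := by push_cast; ring
  have := SS_step Y (s+2*K) _ _ hH hx hD (FP_summable Y hY s hs K) 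
    (by rw [← e]; exact FP_summable Y hY s hs (K+1))
    (FN_summable Y hY hY1 s hs K) 
    (by rw [← e]; exact FN_summable Y hY hY1 s hs (K+1))
    (eP_lim_shift Y s Ep hH hs.1 hp K) (eN_lim_shift Y s En hH hs.1 hn K)
  have p := (p1_eq Y (s+2*K) hD).resolve_right hx.ne
  rw [e, this]
  have := hs.1.ne
  linear_combination ((Ep-En)/s) * p

end ZS
end

section
open Filter Topology Finset
namespace ZS

lemma eP_neg (Y x : ℂ) (m : ℕ) : eP Y (-x) m = eP Y x m := by simp only [eP, neg_sq]
lemma eN_neg (Y x : ℂ) (m : ℕ) : eN Y (-x) m = eN Y x m := by simp only [eN, neg_sq]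
lemma SS_neg (Y x : ℂ) : SS Y (-x) = SS Y x := by simp only [SS, FP, FN, eP_neg, eN_neg]

lemma eP_one (Y x : ℂ) (hY : HY Y) (h : x^2 = -Y) (m : ℕ) : eP Y x m = 1 := by
  unfold eP
  apply prod_eq_one
  intro j _
  have a1 := hY (2*j+1); have a2 := hY (2*j+2)
  rw [h]
  push_cast at *
  rw [sub_neg_eq_add, sub_neg_eq_add, div_self (mul_ne_zero a2 a1)]

lemma eN_one (Y x : ℂ) (hY : HY Y) (h : x^2 = -Y) (m : ℕ) : eN Y x m = 1 := by
  unfold eN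
  apply prod_eq_one
  intro j _
  have a1 := hY (2*j+1); have a2 := hY (2*j)
  rw [h]
  push_cast at *
  rw [sub_neg_eq_add, sub_neg_eq_add, div_self (mul_ne_zero a2 a1)]

lemma inv_quad_tendsto (Y : ℂ) (f : ℕ → ℂ) (h0 : ∀ᶠ m in atTop, f m ≠ 0)
    (hf : Tendsto (fun m => (f m)⁻¹) atTop (𝓝 0)) :
    Tendsto (fun m => 1/(f m*((f m)^2+Y))) atTop (𝓝 0) := by
  have hc : ContinuousAt (fun u : ℂ => u^3/(1+Y*u^2)) 0 := by
    apply ContinuousAt.div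
    · fun_prop
    · fun_prop
    · simp
  have h := hc.tendsto.comp hf
  simp only [ne_eq, OfNat.ofNat_ne_zero, not_false_eq_true, zero_pow, zero_div] at h
  refine h.congr' ?_
  filter_upwards [h0] with m hm
  simp only [Function.comp_apply]
  have e3 : (f m)^2+Y = (f m)^2*(1+Y*((f m)⁻¹)^2) := by field_simp
  rw [e3]
  generalize 1+Y*((f m)⁻¹)^2 = q
  rw [div_eq_mul_inv, div_eq_mul_inv, mul_inv, mul_inv]
  field_simp

noncomputable def g2 (Y k : ℂ) : ℂ := -3/(((k-1)^2+Y)*(k^2+Y))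

lemma g2_tendsto (Y : ℂ) (f : ℕ → ℂ) (h0 : ∀ᶠ m in atTop, f m ≠ 0)
    (hf : Tendsto (fun m => (f m)⁻¹) atTop (𝓝 0)) :
    Tendsto (fun m => g2 Y (f m)) atTop (𝓝 0) := by
  have hc : ContinuousAt (fun u : ℂ => -3*u^4/(((1-u)^2+Y*u^2)*(1+Y*u^2))) 0 := by
    apply ContinuousAt.div
    · fun_prop
    · fun_prop
    · simp
  have h := hc.tendsto.comp hf
  simp only [ne_eq, OfNat.ofNat_ne_zero, not_false_eq_true, zero_pow, zero_div, mul_zero] at h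
  refine h.congr' ?_
  filter_upwards [h0] with m hm
  simp only [Function.comp_apply]
  unfold g2
  have e3 : (f m)^2+Y = (f m)^2*(1+Y*((f m)⁻¹)^2) := by field_simp
  have e4 : (f m-1)^2+Y = (f m)^2*((1-(f m)⁻¹)^2+Y*((f m)⁻¹)^2) := by field_simp
  rw [e3, e4]
  generalize 1+Y*((f m)⁻¹)^2 = q
  generalize (1-(f m)⁻¹)^2+Y*((f m)⁻¹)^2 = r
  rw [div_eq_mul_inv, div_eq_mul_inv, mul_inv, mul_inv, mul_inv, mul_inv]
  field_simp

lemma core2 (Y x k : ℂ) (hx : x ≠ 0) (h : x^2 = -Y) (hk : k ≠ 0) (hk1 : k+1 ≠ 0)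
    (h1 : (k-1)^2+Y ≠ 0) (h2 : (k+2)^2+Y ≠ 0) (h5 : k^2+Y ≠ 0) (h6 : (k+1)^2+Y ≠ 0) :
    (RR x k - 1) * wt Y k + (RR (-x) k - 1) * wt Y k = g2 Y (k+2) - g2 Y k := by
  have f1 : (k-1)^2+Y = (k-1-x)*(k-1- -x) := by linear_combination h
  have f2 : (k+2)^2+Y = (k+2+x)*(k+2+-x) := by linear_combination h
  rw [f1] at h1
  rw [f2] at h2
  have a1 := left_ne_zero_of_mul h1
  have a2 := right_ne_zero_of_mul h1
  have b1 := left_ne_zero_of_mul h2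
  have b2 := right_ne_zero_of_mul h2
  rw [core1 Y x k hx a1 b1 hk hk1 h5 h6, core1 Y (-x) k (neg_ne_zero.2 hx) a2 b2 hk hk1 h5 h6]
  unfold g2
  have e : k+2-1 = k+1 := by ring
  have f3 : k^2+Y = (k-x)*(k+x) := by linear_combination h
  have f4 : (k+1)^2+Y = (k+1-x)*(k+1+x) := by linear_combination h
  rw [f2, f1, e]
  rw [f3] at h5 ⊢
  rw [f4] at h6 ⊢
  have c1 := left_ne_zero_of_mul h5
  have c2 := right_ne_zero_of_mul h5
  have d1 := left_ne_zero_of_mul h6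
  have d2 := right_ne_zero_of_mul h6
  have hY : Y = -x^2 := by rw [h]; ring
  rw [hY]
  have a2' : k - 1 + x ≠ 0 := by simpa using a2
  have b2' : k + 2 - x ≠ 0 := by simpa [sub_eq_add_neg] using b2
  have a3 : k-1- -x = k-1+x := by ring
  have b3 : k+2+-x = k+2-x := by ring
  rw [a3, b3]
  field_simp
  ring

lemma SS_zero (Y : ℝ) (hY : 0 < Y) (hY1 : Y ≤ 1) (s : ℂ) (hs : good s) (h : s^2 = -Y) :
    SS Y s = 0 := by
  have hH := HY_real Y hY
  have s1 : Summable (FP Y s) := by simpa using FP_summable Y hY s hs 0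
  have s2 : Summable (FN Y s) := by simpa using FN_summable Y hY hY1 s hs 0
  unfold SS
  rw [← s1.tsum_add s2]
  have t := (s1.add s2).hasSum.tendsto_sum_nat
  have p : ∀ M, ∑ m ∈ range M, (FP Y s m + FN Y s m) = -(1/(((2*M:ℕ):ℂ)*(((2*M:ℕ):ℂ)^2+Y))) := by
    intro M
    induction M with
    | zero => simp
    | succ M ih =>
      rw [sum_range_succ, ih]
      simp only [FP, FN, eP_one Y s hH h, eN_one Y s hH h, one_mul, wt]
      have e1 : -((2*M+2:ℕ):ℂ)+1 = -(((2*M:ℕ):ℂ)+1) := by push_cast; ring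
      have e2 : 2*(M+1) = 2*M+2 := by ring
      rw [e1, e2, neg_sq, neg_sq, neg_mul, neg_mul, one_div_neg_eq_neg_one_div,
        one_div_neg_eq_neg_one_div]
      ring
  have l := (inv_quad_tendsto (Y:ℂ) _ seqP_ne seqP_inv).neg
  rw [neg_zero] at l
  exact tendsto_nhds_unique (t.congr p) l

lemma SS_first (Y : ℝ) (hY : 0 < Y) (hY1 : Y ≤ 1) (s : ℂ) (hs : good s) (hs' : good (-s))
    (h : s^2 = -Y) :
    SS Y (s+2) + SS Y (-s+2) - 2*SS Y s = (tt s + tt (-s))/Y := by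
  have hH := HY_real Y hY
  have hx := hs.1
  have h' : (-s)^2 = -Y := by rw [neg_sq, h]
  have sp0 : Summable (FP Y s) := by simpa using FP_summable Y hY s hs 0
  have sn0 : Summable (FN Y s) := by simpa using FN_summable Y hY hY1 s hs 0
  have sp1 : Summable (FP Y (s+2)) := by simpa using FP_summable Y hY s hs 1
  have sn1 : Summable (FN Y (s+2)) := by simpa using FN_summable Y hY hY1 s hs 1
  have sp2 : Summable (FP Y (-s+2)) := by simpa using FP_summable Y hY (-s) hs' 1
  have sn2 : Summable (FN Y (-s+2)) := by simpa using FN_summable Y hY hY1 (-s) hs' 1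
  have kp := ((sp1.hasSum.add sp2.hasSum).sub (sp0.hasSum.mul_left 2))
  have kn := ((sn1.hasSum.add sn2.hasSum).sub (sn0.hasSum.mul_left 2))
  have tp := kp.tendsto_sum_nat.comp (tendsto_add_atTop_nat 1)
  have tn := kn.tendsto_sum_nat
  have a1 : ∀ M, ∑ m ∈ range (M+1), (FP Y (s+2) m + FP Y (-s+2) m - 2*FP Y s m) =
      g2 Y ((2*(M+1):ℕ):ℂ) - g2 Y ((2:ℕ):ℂ) := by
    intro M
    induction M with
    | zero => simp [FP, eP]; ring
    | succ M ih =>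
      rw [sum_range_succ, ih]
      unfold FP
      rw [eP_shift Y s hH hx, eP_shift Y (-s) hH hx.neg, eP_one Y s hH h, eP_one Y (-s) hH h']
      have c1 := hH (2*M+1); have c2 := hH (2*M+4); have c3 := hH (2*M+2); have c4 := hH (2*M+3)
      have := core2 Y s ((2*(M+1):ℕ):ℂ) hx.ne h (by exact_mod_cast (by omega : 2*(M+1) ≠ 0))
        (by exact_mod_cast (by omega : 2*(M+1)+1 ≠ 0))
        (by convert c1 using 2; push_cast; ring)
        (by convert c2 using 2; push_cast; ring)
        (by convert c3 using 2; push_cast; ring)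
        (by convert c4 using 2; push_cast; ring)
      have e : ((2*(M+1):ℕ):ℂ)+2 = ((2*(M+1+1):ℕ):ℂ) := by push_cast; ring
      rw [e] at this
      linear_combination this
  have a2 : ∀ N, ∑ n ∈ range N, (FN Y (s+2) n + FN Y (-s+2) n - 2*FN Y s n) =
      g2 Y 0 - g2 Y (-((2*N:ℕ):ℂ)) := by
    intro M
    induction M with
    | zero => simp
    | succ M ih =>
      rw [sum_range_succ, ih]
      unfold FN
      rw [eN_shift Y s hH hx, eN_shift Y (-s) hH hx.neg, eN_one Y s hH h, eN_one Y (-s) hH h']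
      have c1 := hH (2*M+3); have c2 := hH (2*M); have c3 := hH (2*M+2); have c4 := hH (2*M+1)
      have := core2 Y s (-((2*(M+1):ℕ):ℂ)) hx.ne h 
        (by rw [neg_ne_zero]; exact_mod_cast (by omega : 2*(M+1) ≠ 0))
        (by 
          have : ((2*M+1:ℕ):ℂ) ≠ 0 := by exact_mod_cast (by omega : 2*M+1 ≠ 0)
          rw [← neg_ne_zero]; convert this using 1; push_cast; ring)
        (by convert c1 using 1; push_cast; ring)
        (by convert c2 using 1; push_cast; ring)
        (by convert c3 using 1; push_cast; ring)
        (by convert c4 using 1; push_cast; ring)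
      have e : -((2*(M+1):ℕ):ℂ)+2 = -((2*M:ℕ):ℂ) := by push_cast; ring
      rw [e] at this
      have e00 : 2*M+2 = 2*(M+1) := by ring
      rw [e00]
      linear_combination this
  have l1 := ((g2_tendsto (Y:ℂ) _ seqP_ne seqP_inv).comp (tendsto_add_atTop_nat 1)).sub_const
    (g2 Y ((2:ℕ):ℂ))
  have l2 := (g2_tendsto (Y:ℂ) _ seqN_ne seqN_inv).const_sub (g2 Y 0)
  have u1 := tendsto_nhds_unique (tp.congr (fun M => a1 M)) l1
  have u2 := tendsto_nhds_unique (tn.congr (fun M => a2 M)) l2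
  have fin : g2 Y 0 - g2 Y ((2:ℕ):ℂ) = (tt s + tt (-s))/Y := by
    unfold g2 tt
    have hYe : (Y:ℂ) = -s^2 := by rw [h]; ring
    have d0 := hx.ne; have d1 := hx.add 1; have d2 := hx.add 2
    have d3 := hx.neg.add 1; have d4 := hx.neg.add 2
    push_cast at *
    rw [hYe]
    have q1 : ((0:ℂ)-1)^2 + -s^2 = (s+1)*(-s+1) := by ring
    have q2 : (0:ℂ)^2 + -s^2 = -(s*s) := by ring
    have q3 : ((2:ℂ)-1)^2 + -s^2 = (s+1)*(-s+1) := by ring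
    have q4 : (2:ℂ)^2 + -s^2 = (s+2)*(-s+2) := by ring
    rw [q1,q2,q3,q4]
    field_simp
    ring
  unfold SS
  rw [← fin]
  linear_combination u1 + u2

end ZS
end

section
open Filter Topology Finset
namespace ZS

noncomputable def dZ (v : ℂ) (j : ℕ) : ℂ := (j:ℂ)/((j:ℂ)^4-v)
noncomputable def Zf (v : ℂ) : ℂ := ∑' j, dZ v j

lemma dZ_norm (v : ℂ) (hv : ‖v‖ < 1) (j : ℕ) : ‖dZ v j‖ ≤ (1/(1-‖v‖)) * (1/(j:ℝ)^3) := by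
  unfold dZ
  rcases Nat.eq_zero_or_pos j with h | h
  · subst h; simp
  have hj : (1:ℝ) ≤ j := by exact_mod_cast h
  rw [norm_div, Complex.norm_natCast]
  have h1 : (j:ℝ)^4*(1-‖v‖) ≤ ‖(j:ℂ)^4-v‖ := by
    have := norm_sub_norm_le ((j:ℂ)^4) v
    rw [norm_pow, Complex.norm_natCast] at this
    have h4 : (1:ℝ) ≤ (j:ℝ)^4 := one_le_pow₀ hj
    nlinarith [norm_nonneg v]
  have h2 : 0 < 1-‖v‖ := by linarith
  calc _ ≤ (j:ℝ)/((j:ℝ)^4*(1-‖v‖)) := by gcongr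
    _ = _ := by field_simp

lemma dZ_summable (v : ℂ) (hv : ‖v‖ < 1) : Summable (dZ v) := by
  refine Summable.of_norm_bounded ?_ (dZ_norm v hv)
  exact ((Real.summable_one_div_nat_pow).2 (by norm_num)).mul_left _

noncomputable def th (s : ℂ) (j : ℕ) : ℂ := 1/(s+j) + 1/(-s+j)

lemma th_eq (s : ℂ) (hs : NI s) (j : ℕ) : th s j = 2*j/((j:ℂ)^2-s^2) := by
  unfold th
  have h1 := hs.add j; have h2 := hs.neg.add j
  push_cast at h1 h2
  rw [show (j:ℂ)^2-s^2 = (s+j)*(-s+j) by ring]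
  field_simp
  ring

lemma tt_eq (s : ℂ) (hs : NI s) : tt s = 1/s - 2*(1/(s+1)) + 1/(s+2) := by
  have h0 := hs.ne; have h1 := hs.add 1; have h2 := hs.add 2
  push_cast at h1 h2
  unfold tt
  field_simp
  ring

lemma tt_pair (s : ℂ) (hs : NI s) (i : ℕ) :
    tt (s+2*i) + tt (-s+2*i) = th s (2*i) - 2*th s (2*i+1) + th s (2*i+2) := by
  have h1 : NI (s+2*i) := by simpa using hs.shift (2*i)
  have h2 : NI (-s+2*i) := by simpa using hs.neg.shift (2*i)
  rw [tt_eq _ h1, tt_eq _ h2]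
  unfold th
  push_cast
  ring_nf

lemma th_diff (z s : ℂ) (hz : NI z) (hs : NI s) (h : s^2 = -z^2) (j : ℕ) :
    th s j - th z j = -4*z^2*dZ (z^4) j := by
  rw [th_eq _ hz, th_eq _ hs, h]
  have a1 := hz.sq j; have a2 := hs.sq j
  rw [h] at a2
  push_cast at a1 a2
  unfold dZ
  rw [show (j:ℂ)^4-z^4 = ((j:ℂ)^2-z^2)*((j:ℂ)^2- -z^2) by ring]
  field_simp
  ring

lemma gpart (z : ℝ) (hz : 0 < z) (i : ℕ) :
    1/((-(z:ℂ)+2*i)^2+(z:ℂ)^2) - 1/(((z:ℂ)+2*i)^2+(z:ℂ)^2) = z*(1/2)*dZ (-(z:ℂ)^4/4) i := by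
  have h1 : (-(z:ℂ)+2*i)^2+(z:ℂ)^2 ≠ 0 := by
    have : (-z+2*i)^2+z^2 ≠ 0 := by positivity
    exact_mod_cast this
  have h2 : ((z:ℂ)+2*i)^2+(z:ℂ)^2 ≠ 0 := by
    have : (z+2*i)^2+z^2 ≠ 0 := by positivity
    exact_mod_cast this
  unfold dZ
  rw [show (i:ℂ)^4 - -(z:ℂ)^4/4 = ((-(z:ℂ)+2*i)^2+(z:ℂ)^2)*(((z:ℂ)+2*i)^2+(z:ℂ)^2)/16 by ring]
  field_simp
  ring

lemma NI_of_re {s : ℂ} (h0 : 0 < s.re) (h1 : s.re < 1) : NI s := by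
  intro n h
  rw [h] at h0 h1
  simp only [Complex.intCast_re] at h0 h1
  have : 0 < n := by exact_mod_cast h0
  have : n < 1 := by exact_mod_cast h1
  omega

lemma NI_of_im {s : ℂ} (h0 : s.im ≠ 0) : NI s := by
  intro n h
  rw [h] at h0
  simp at h0

lemma good_z (z : ℝ) (hz : 0 < z) (hz1 : z ≤ 1/4) : good (z:ℂ) := by
  refine ⟨NI_of_re (by simpa) (by simp; linarith), ?_, ?_⟩ <;> simp <;> linarith
lemma good_nz (z : ℝ) (hz : 0 < z) (hz1 : z ≤ 1/4) : good (-(z:ℂ)) := by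
  refine ⟨(good_z z hz hz1).1.neg, ?_, ?_⟩ <;> simp <;> linarith
lemma good_Iz (z : ℝ) (hz : 0 < z) : good (Complex.I*z) := by
  refine ⟨NI_of_im (by simp; linarith), ?_, ?_⟩ <;> simp
lemma good_nIz (z : ℝ) (hz : 0 < z) : good (-(Complex.I*z)) := by
  refine ⟨(good_Iz z hz).1.neg, ?_, ?_⟩ <;> simp

lemma DD_real (Y : ℝ) (hY : 0 < Y) (r : ℝ) : DD Y r ≠ 0 := by
  have : (r^2+Y)*((r+2)^2+Y) ≠ 0 := by positivity
  unfold DD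
  exact_mod_cast this

lemma DD_I (Y s : ℂ) (hs : NI s) (h : s^2 = -Y) (K : ℕ) : DD Y (s+2*(K+1:ℕ)) ≠ 0 := by
  have h1 := hs.add (K+1); have h2 := hs.add (K+2)
  have k1 : ((K+1:ℕ):ℂ) ≠ 0 := by exact_mod_cast (by omega : K+1 ≠ 0)
  have k2 : ((K+2:ℕ):ℂ) ≠ 0 := by exact_mod_cast (by omega : K+2 ≠ 0)
  push_cast at *
  have e : DD Y (s+2*(K+1)) = 16*(((K:ℂ)+1)*(s+(K+1)))*(((K:ℂ)+2)*(s+(K+2))) := by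
    unfold DD
    have hY : Y = -s^2 := by rw [h]; ring
    rw [hY]; ring
  rw [e]
  exact mul_ne_zero (mul_ne_zero (by norm_num) (mul_ne_zero k1 h1)) (mul_ne_zero k2 h2)

lemma partZ (z : ℝ) (hz : 0 < z) (hz1 : z ≤ 1/4) (Ep En : ℂ)
    (hp : Tendsto (eP ((z^2:ℝ):ℂ) z) atTop (𝓝 Ep)) (hn : Tendsto (eN ((z^2:ℝ):ℂ) z) atTop (𝓝 En))
    (K : ℕ) :
    SS ((z^2:ℝ):ℂ) (z+2*K) + SS ((z^2:ℝ):ℂ) (-z+2*K) - 2*SS ((z^2:ℝ):ℂ) z = 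
      ∑ i ∈ range K, ((Ep-En)/2*(dZ (-(z:ℂ)^4/4) i + dZ (-(z:ℂ)^4/4) (i+1))
        + (tt (z+2*i) + tt (-z+2*i))/((z^2:ℝ):ℂ)) := by
  have hY : 0 < z^2 := by positivity
  have hY1 : z^2 ≤ 1 := by nlinarith
  induction K with
  | zero => simp [SS_neg]; ring
  | succ K ih =>
    rw [sum_range_succ, ← ih]
    have a := SS_step' (z^2) hY hY1 z Ep En (good_z z hz hz1) K
      (by have := DD_real (z^2) hY (z+2*K); push_cast at *; exact this) hp hn
    have b := SS_step' (z^2) hY hY1 (-z) Ep En (good_nz z hz hz1) K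
      (by have := DD_real (z^2) hY (-z+2*K); push_cast at *; exact this) 
      (hp.congr (fun m => (eP_neg _ _ m).symm)) (hn.congr (fun m => (eN_neg _ _ m).symm))
    have c := gpart z hz K
    have d := gpart z hz (K+1)
    have hz0 : (z:ℂ) ≠ 0 := by exact_mod_cast hz.ne'
    have e : ((z^2:ℝ):ℂ) = (z:ℂ)^2 := by push_cast; rfl
    simp only [e] at *
    have cd : ((Ep-En)/2*(dZ (-(z:ℂ)^4/4) K + dZ (-(z:ℂ)^4/4) (K+1))) =
      (Ep-En)/z*((z:ℂ)*(1/2)*dZ (-(z:ℂ)^4/4) K + (z:ℂ)*(1/2)*dZ (-(z:ℂ)^4/4) (K+1)) := by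
      field_simp
    rw [cd, ← c, ← d]
    rw [div_neg] at b
    linear_combination a + b

lemma partI (z : ℝ) (hz : 0 < z) (hz1 : z ≤ 1/4) (s : ℂ) (hse : s = Complex.I*z)
    (K : ℕ) :
    SS ((z^2:ℝ):ℂ) (s+2*K) + SS ((z^2:ℝ):ℂ) (-s+2*K) - 2*SS ((z^2:ℝ):ℂ) s = 
      ∑ i ∈ range K, ((tt (s+2*i) + tt (-s+2*i))/((z^2:ℝ):ℂ)) := by
  have hY : 0 < z^2 := by positivity
  have hY1 : z^2 ≤ 1 := by nlinarith
  have hg : good s := by rw [hse]; exact good_Iz z hz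
  have hg' : good (-s) := by rw [hse]; exact good_nIz z hz
  have hs : s^2 = -((z^2:ℝ):ℂ) := by rw [hse, mul_pow, Complex.I_sq]; push_cast; ring
  have hs' : (-s)^2 = -((z^2:ℝ):ℂ) := by rw [neg_sq, hs]
  have hH := HY_real (z^2) hY
  have lp : Tendsto (eP ((z^2:ℝ):ℂ) s) atTop (𝓝 1) :=
    tendsto_const_nhds.congr (fun m => (eP_one _ _ hH hs m).symm)
  have ln : Tendsto (eN ((z^2:ℝ):ℂ) s) atTop (𝓝 1) :=
    tendsto_const_nhds.congr (fun m => (eN_one _ _ hH hs m).symm)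
  have lp' : Tendsto (eP ((z^2:ℝ):ℂ) (-s)) atTop (𝓝 1) :=
    tendsto_const_nhds.congr (fun m => (eP_one _ _ hH hs' m).symm)
  have ln' : Tendsto (eN ((z^2:ℝ):ℂ) (-s)) atTop (𝓝 1) :=
    tendsto_const_nhds.congr (fun m => (eN_one _ _ hH hs' m).symm)
  induction K with
  | zero => simp [SS_neg]; ring
  | succ K ih =>
    rw [sum_range_succ, ← ih]
    rcases K with _ | K
    · have := SS_first (z^2) hY hY1 s hg hg' hs
      simp [SS_neg] at *
      linear_combination this
    · have a := SS_step' (z^2) hY hY1 s 1 1 hg (K+1) (DD_I _ _ hg.1 hs K) lp ln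
      have b := SS_step' (z^2) hY hY1 (-s) 1 1 hg' (K+1) (DD_I _ _ hg'.1 hs' K) lp' ln'
      simp only [sub_self, zero_div, neg_zero, zero_mul, zero_add] at a b
      linear_combination a + b

theorem SS_eval (z : ℝ) (hz : 0 < z) (hz1 : z ≤ 1/4) (Ep En : ℂ)
    (hp : Tendsto (eP ((z^2:ℝ):ℂ) z) atTop (𝓝 Ep)) (hn : Tendsto (eN ((z^2:ℝ):ℂ) z) atTop (𝓝 En)) :
    SS ((z^2:ℝ):ℂ) z = 4*Zf ((z:ℂ)^4) - Zf ((z:ℂ)^4/16) - (Ep-En)/2*Zf (-(z:ℂ)^4/4) := by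
  have hY : 0 < z^2 := by positivity
  have hY1 : z^2 ≤ 1 := by nlinarith
  have hz0 : (z:ℂ) ≠ 0 := by exact_mod_cast hz.ne'
  have hw : ‖(z:ℂ)^4‖ < 1 := by
    rw [norm_pow, Complex.norm_real, Real.norm_of_nonneg hz.le]
    exact pow_lt_one₀ hz.le (by linarith) (by norm_num)
  have hw2 : ‖-(z:ℂ)^4/4‖ < 1 := by
    rw [norm_div, norm_neg]; norm_num; norm_num at hw; linarith
  set s : ℂ := Complex.I*z with hse
  have hg : good s := by rw [hse]; exact good_Iz z hz
  have hg' : good (-s) := by rw [hse]; exact good_nIz z hz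
  have hs : s^2 = -((z^2:ℝ):ℂ) := by rw [hse, mul_pow, Complex.I_sq]; push_cast; ring
  have gz := good_z z hz hz1
  have gnz := good_nz z hz hz1
  have t1 := ((SS_tendsto8 (z^2) hY hY1 z gz).add (SS_tendsto8 (z^2) hY hY1 (-z) gnz)).sub_const
    (2*SS ((z^2:ℝ):ℂ) z)
  have t2 := ((SS_tendsto8 (z^2) hY hY1 s hg).add (SS_tendsto8 (z^2) hY hY1 (-s) hg')).sub_const
    (2*SS ((z^2:ℝ):ℂ) s)
  have t3 := t2.sub t1
  have dS := dZ_summable _ hw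
  have dT := dZ_summable _ hw2
  set d := dZ ((z:ℂ)^4) with hd
  set g := dZ (-(z:ℂ)^4/4) with hgd
  have dE : Summable (fun i => d (2*i)) := dS.comp_injective (fun a b h => by simpa using h)
  have dO : Summable (fun i => d (2*i+1)) := dS.comp_injective (fun a b h => by simpa using h)
  have hE1 : HasSum (fun i => d (2*i+2)) (∑' i, d (2*i)) := by
    have h := (hasSum_nat_add_iff' (f := fun i => d (2*i)) 1).2 dE.hasSum
    have z0 : d 0 = 0 := by simp [hd, dZ]
    simpa [z0, mul_add] using h
  have hg1 : HasSum (fun i => g (i+1)) (∑' i, g i) := by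
    have h := (hasSum_nat_add_iff' (f := g) 1).2 dT.hasSum
    have z0 : g 0 = 0 := by simp [hgd, dZ]
    simpa [z0] using h
  have HS := ((dE.hasSum.sub (dO.hasSum.mul_left 2)).add hE1).mul_left (-4)
  have HS2 := HS.sub ((dT.hasSum.add hg1).mul_left ((Ep-En)/2))
  have t4 := HS2.tendsto_sum_nat
  have key := tendsto_nhds_unique t3 (t4.congr (fun K => by
    rw [partI z hz hz1 s hse K, partZ z hz hz1 Ep En hp hn K, ← sum_sub_distrib]
    apply sum_congr rfl
    intro i _
    rw [tt_pair s hg.1, tt_pair z gz.1]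
    have h' : s^2 = -(z:ℂ)^2 := by rw [hs]; push_cast; ring
    have a0 := th_diff z s gz.1 hg.1 h' (2*i)
    have a1 := th_diff z s gz.1 hg.1 h' (2*i+1)
    have a2 := th_diff z s gz.1 hg.1 h' (2*i+2)
    rw [← hd] at a0 a1 a2
    have e : ((z^2:ℝ):ℂ) = (z:ℂ)^2 := by push_cast; rfl
    rw [e, ← hgd]
    have b0 : (th s (2*i) - th z (2*i))/(z:ℂ)^2 = -4*d (2*i) := by rw [a0]; field_simp
    have b1 : (th s (2*i+1) - th z (2*i+1))/(z:ℂ)^2 = -4*d (2*i+1) := by rw [a1]; field_simp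
    have b2 : (th s (2*i+2) - th z (2*i+2))/(z:ℂ)^2 = -4*d (2*i+2) := by rw [a2]; field_simp
    linear_combination -b0 + 2*b1 - b2))
  have z1 := SS_zero (z^2) hY hY1 s hg hs
  have oe := tsum_even_add_odd dE dO
  have ev : ∑' i, d (2*i) = (1/8) * Zf ((z:ℂ)^4/16) := by
    unfold Zf
    rw [← tsum_mul_left]
    congr 1
    ext i
    rw [hd]; unfold dZ
    push_cast
    rw [show (2*(i:ℂ))^4-(z:ℂ)^4 = 16*((i:ℂ)^4-(z:ℂ)^4/16) by ring, ← div_div]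
    ring
  have q1 : Zf ((z:ℂ)^4) = ∑' i, d i := rfl
  have q2 : Zf (-(z:ℂ)^4/4) = ∑' i, g i := rfl
  rw [z1] at key
  rw [q1, q2, ← oe]
  linear_combination (1/2)*key - 8 * ev
end ZS
end

section
open Filter Topology Finset
namespace ZS

noncomputable def Qn (x : ℂ) (n : ℕ) : ℂ := ∏ j ∈ range n, (1 - x^2/((j:ℂ)+1)^2)

lemma Qn_tendsto (x : ℂ) (hx : x ≠ 0) :
    Tendsto (Qn x) atTop (𝓝 (Complex.sin (Real.pi*x)/(Real.pi*x))) := by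
  have h := (Complex.tendsto_euler_sin_prod x).div_const (Real.pi*x)
  have h0 : (Real.pi:ℂ)*x ≠ 0 := mul_ne_zero (by exact_mod_cast Real.pi_ne_zero) hx
  refine h.congr (fun n => ?_)
  rw [mul_div_cancel_left₀ _ h0]; rfl

lemma eP_Qn (z : ℂ) (hz : NI z) (hY : HY (z^2)) (m : ℕ) :
    eP (z^2) z m * (Qn (z/2) m^2 * Qn (Complex.I*z) (2*m)) =
      Qn (Complex.I*z/2) m^2 * Qn z (2*m) := by
  induction m with
  | zero => simp [eP, Qn]
  | succ m ih =>
    have e2 : 2*(m+1) = 2*m+1+1 := by ring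
    have q : ∀ x n, Qn x (n+1) = Qn x n * (1 - x^2/((n:ℂ)+1)^2) := fun x n => prod_range_succ _ _
    rw [e2]
    simp only [q]
    rw [eP_succ]
    set k : ℂ := 2*(m:ℂ) with hk
    have k1 : k+1 ≠ 0 := by rw [hk]; exact_mod_cast (by omega : 2*m+1 ≠ 0)
    have k2 : k+2 ≠ 0 := by rw [hk]; exact_mod_cast (by omega : 2*m+2 ≠ 0)
    have hm1 : (m:ℂ)+1 = (k+2)/2 := by rw [hk]; ring
    have a1 := hz.sq (2*m+1); have a2 := hz.sq (2*m+2)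
    have b1 := hY (2*m+1); have b2 := hY (2*m+2)
    push_cast at *
    rw [← hk] at *
    have st' : st (z^2) z k * ((1-(z/2)^2/((m:ℂ)+1)^2)^2 * ((1-(Complex.I*z)^2/(k+1)^2)*(1-(Complex.I*z)^2/(k+1+1)^2)))
        = (1-(Complex.I*z/2)^2/((m:ℂ)+1)^2)^2 * ((1-z^2/(k+1)^2)*(1-z^2/(k+1+1)^2)) := by
      rw [hm1]
      have c1 : 1-(z/2)^2/((k+2)/2)^2 = ((k+2)^2-z^2)/(k+2)^2 := by field_simp
      have c2 : 1-(Complex.I*z)^2/(k+1)^2 = ((k+1)^2+z^2)/(k+1)^2 := by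
        rw [mul_pow, Complex.I_sq]; field_simp; ring
      have c3 : 1-(Complex.I*z)^2/(k+1+1)^2 = ((k+2)^2+z^2)/(k+2)^2 := by
        rw [mul_pow, Complex.I_sq, show k+1+1 = k+2 by ring]; field_simp; ring
      have c4 : 1-(Complex.I*z/2)^2/((k+2)/2)^2 = ((k+2)^2+z^2)/(k+2)^2 := by
        rw [div_pow, mul_pow, Complex.I_sq]; field_simp; ring
      have c5 : 1-z^2/(k+1)^2 = ((k+1)^2-z^2)/(k+1)^2 := by field_simp
      have c6 : 1-z^2/(k+1+1)^2 = ((k+2)^2-z^2)/(k+2)^2 := by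
        rw [show k+1+1 = k+2 by ring]; field_simp
      rw [c1,c2,c3,c4,c5,c6]
      unfold st
      field_simp
    linear_combination (st (z^2) z k * ((1-(z/2)^2/((m:ℂ)+1)^2)^2 * ((1-(Complex.I*z)^2/(k+1)^2)*(1-(Complex.I*z)^2/(k+1+1)^2)))) * ih + Qn (Complex.I*z/2) m^2 * Qn z (2*m) * st'

noncomputable def tau (z : ℝ) : ℝ :=
  (Real.sinh (Real.pi*z/2) * Real.cos (Real.pi*z/2))/(Real.cosh (Real.pi*z/2) * Real.sin (Real.pi*z/2))

lemma tau_pos (z : ℝ) (hz : 0 < z) (hz1 : z ≤ 1/4) : 0 < tau z := by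
  have hp := Real.pi_pos
  have h1 : 0 < Real.pi*z/2 := by positivity
  have h2 : Real.pi*z/2 < Real.pi/2 := by nlinarith
  have a1 : 0 < Real.sinh (Real.pi*z/2) := Real.sinh_pos_iff.2 h1
  have a2 := Real.cosh_pos (Real.pi*z/2)
  have a3 : 0 < Real.sin (Real.pi*z/2) := Real.sin_pos_of_pos_of_lt_pi h1 (by linarith)
  have a4 : 0 < Real.cos (Real.pi*z/2) := Real.cos_pos_of_mem_Ioo ⟨by linarith, h2⟩
  unfold tau; positivity

lemma eP_lim (z : ℝ) (hz : 0 < z) (hz1 : z ≤ 1/4) :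
    Tendsto (eP ((z^2:ℝ):ℂ) z) atTop (𝓝 (tau z:ℂ)) := by
  have hp := Real.pi_pos
  have hz0 : (z:ℂ) ≠ 0 := by exact_mod_cast hz.ne'
  have hI := Complex.I_ne_zero
  have hpi : (Real.pi:ℂ) ≠ 0 := by exact_mod_cast Real.pi_ne_zero
  have h1 : 0 < Real.pi*z/2 := by positivity
  have h2 : Real.pi*z/2 < Real.pi/2 := by nlinarith
  have a1 : 0 < Real.sinh (Real.pi*z/2) := Real.sinh_pos_iff.2 h1
  have a2 := Real.cosh_pos (Real.pi*z/2)
  have a3 : 0 < Real.sin (Real.pi*z/2) := Real.sin_pos_of_pos_of_lt_pi h1 (by linarith)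
  have a4 : 0 < Real.cos (Real.pi*z/2) := Real.cos_pos_of_mem_Ioo ⟨by linarith, h2⟩
  have b1 : Complex.sinh (Real.pi*z/2) ≠ 0 := by exact_mod_cast a1.ne'
  have b2 : Complex.cosh (Real.pi*z/2) ≠ 0 := by exact_mod_cast a2.ne'
  have b3 : Complex.sin (Real.pi*z/2) ≠ 0 := by exact_mod_cast a3.ne'
  have b4 : Complex.cos (Real.pi*z/2) ≠ 0 := by exact_mod_cast a4.ne'
  have t1 := Qn_tendsto (z/2) (by simpa using hz0)
  have dbl : Tendsto (fun m : ℕ => 2*m) atTop atTop := tendsto_id.const_mul_atTop' (by norm_num)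
  have t2 := (Qn_tendsto (Complex.I*z) (mul_ne_zero hI hz0)).comp dbl
  have t3 := Qn_tendsto (Complex.I*z/2) (by simpa using hz0)
  have t4 := (Qn_tendsto z hz0).comp dbl
  have s1 : Complex.sin (Real.pi*(z/2)) = Complex.sin (Real.pi*z/2) := by congr 1; ring
  have s2 : Complex.sin (Real.pi*(Complex.I*z)) =
      2*Complex.sinh (Real.pi*z/2)*Complex.cosh (Real.pi*z/2)*Complex.I := by
    rw [show (Real.pi:ℂ)*(Complex.I*z) = (2*(Real.pi*z/2))*Complex.I by ring, Complex.sin_mul_I,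
      Complex.sinh_two_mul]
  have s3 : Complex.sin (Real.pi*(Complex.I*z/2)) = Complex.sinh (Real.pi*z/2)*Complex.I := by
    rw [show (Real.pi:ℂ)*(Complex.I*z/2) = (Real.pi*z/2)*Complex.I by ring, Complex.sin_mul_I]
  have s4 : Complex.sin (Real.pi*z) = 2*Complex.sin (Real.pi*z/2)*Complex.cos (Real.pi*z/2) := by
    rw [show (Real.pi:ℂ)*z = 2*(Real.pi*z/2) by ring, Complex.sin_two_mul]
    congr 2 <;> ring_nf
  rw [s1] at t1; rw [s2] at t2; rw [s3] at t3; rw [s4] at t4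
  have td := (t1.pow 2).mul t2
  have tn := (t3.pow 2).mul t4
  have nd : (Complex.sin (Real.pi*z/2)/(Real.pi*(z/2)))^2 *
    (2*Complex.sinh (Real.pi*z/2)*Complex.cosh (Real.pi*z/2)*Complex.I/(Real.pi*(Complex.I*z))) ≠ 0 := by
    refine mul_ne_zero (pow_ne_zero _ (div_ne_zero b3 ?_)) (div_ne_zero ?_ ?_)
    · exact mul_ne_zero hpi (by simpa using hz0)
    · exact mul_ne_zero (mul_ne_zero (mul_ne_zero (by norm_num) b1) b2) hI
    · exact mul_ne_zero hpi (mul_ne_zero hI hz0)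
  have tq := tn.div td nd
  have e : (tau z:ℂ) = (Complex.sinh (Real.pi*z/2)*Complex.I/(Real.pi*(Complex.I*z/2)))^2 *
      (2*Complex.sin (Real.pi*z/2)*Complex.cos (Real.pi*z/2)/(Real.pi*z)) /
    ((Complex.sin (Real.pi*z/2)/(Real.pi*(z/2)))^2 *
    (2*Complex.sinh (Real.pi*z/2)*Complex.cosh (Real.pi*z/2)*Complex.I/(Real.pi*(Complex.I*z)))) := by
    unfold tau
    push_cast
    generalize Complex.sinh (Real.pi*z/2) = S at *
    generalize Complex.cosh (Real.pi*z/2) = C at *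
    generalize Complex.sin (Real.pi*z/2) = s at *
    generalize Complex.cos (Real.pi*z/2) = c at *
    field_simp
  rw [e]
  refine tq.congr' ?_
  filter_upwards [td.eventually_ne nd] with m hm
  have := eP_Qn z (good_z z hz hz1).1 (by
    have := HY_real (z^2) (by positivity); push_cast at this; exact this) m
  simp only [Function.comp_apply] at hm ⊢
  push_cast
  simp only [Pi.mul_apply, Pi.div_apply, Pi.pow_apply, Function.comp_apply] at *
  rw [← this]
  exact mul_div_cancel_right₀ _ hm

lemma eN_eq (z : ℝ) (hz : 0 < z) (hz1 : z ≤ 1/4) (n : ℕ) :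
    eN ((z^2:ℝ):ℂ) z n * eP ((z^2:ℝ):ℂ) z n = 
      - (((2*n:ℕ):ℂ)^2+((z^2:ℝ):ℂ))/(((2*n:ℕ):ℂ)^2-(z:ℂ)^2) := by
  have hx := (good_z z hz hz1).1
  have hY := HY_real (z^2) (by positivity)
  induction n with
  | zero =>
    have hz0 : (z:ℂ) ≠ 0 := by exact_mod_cast hz.ne'
    simp [eN, eP]
    rw [div_self (pow_ne_zero 2 hz0)]
  | succ n ih =>
    rw [eP_succ]
    unfold eN at *
    rw [prod_range_succ]
    have a1 := hx.sq (2*n); have a2 := hx.sq (2*n+1); have a3 := hx.sq (2*n+2)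
    have b1 := hY (2*n); have b2 := hY (2*n+1); have b3 := hY (2*n+2)
    unfold st
    push_cast at *
    set k : ℂ := 2*(n:ℂ) with hk
    rw [show 2*((n:ℂ)+1) = k+2 by rw [hk]; ring]
    set A := ∏ j ∈ range n, ((2*(j:ℂ))^2-(z:ℂ)^2)*((2*(j:ℂ)+1)^2+(z:ℂ)^2)/
      (((2*(j:ℂ))^2+(z:ℂ)^2)*((2*(j:ℂ)+1)^2-(z:ℂ)^2)) with hA
    have ih' : A * eP ((z:ℂ)^2) z n = -(k^2+(z:ℂ)^2)/(k^2-(z:ℂ)^2) := ih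
    have : A * ((k^2-(z:ℂ)^2)*((k+1)^2+(z:ℂ)^2)/((k^2+(z:ℂ)^2)*((k+1)^2-(z:ℂ)^2))) *
      (eP ((z:ℂ)^2) z n * (((k+2)^2+(z:ℂ)^2)*((k+1)^2-(z:ℂ)^2)/(((k+2)^2-(z:ℂ)^2)*((k+1)^2+(z:ℂ)^2)))) =
      (A * eP ((z:ℂ)^2) z n) * ((k^2-(z:ℂ)^2)*((k+2)^2+(z:ℂ)^2)/((k^2+(z:ℂ)^2)*((k+2)^2-(z:ℂ)^2))) := by
      field_simp
    rw [this, ih']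
    field_simp

lemma eN_lim (z : ℝ) (hz : 0 < z) (hz1 : z ≤ 1/4) :
    Tendsto (eN ((z^2:ℝ):ℂ) z) atTop (𝓝 (-(1/(tau z:ℂ)))) := by
  have h := eP_lim z hz hz1
  have h0 : (tau z:ℂ) ≠ 0 := by exact_mod_cast (tau_pos z hz hz1).ne'
  have hc : ContinuousAt (fun u : ℂ => -(1+((z^2:ℝ):ℂ)*u^2)/(1-(z:ℂ)^2*u^2)) 0 := by
    apply ContinuousAt.div
    · fun_prop
    · fun_prop
    · simp
  have l := (hc.tendsto.comp seqP_inv).div h h0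
  have e : -(1+((z^2:ℝ):ℂ)*0^2)/(1-(z:ℂ)^2*0^2)/(tau z:ℂ) = -(1/(tau z:ℂ)) := by
    simp; ring
  rw [e] at l
  refine l.congr' ?_
  filter_upwards [h.eventually_ne h0, seqP_ne] with m hm hm2
  simp only [Pi.div_apply, Function.comp_apply]
  rw [div_eq_iff hm, eN_eq z hz hz1]
  set k : ℂ := ((2*m:ℕ):ℂ)
  have c1 : k^2+((z^2:ℝ):ℂ) = k^2*(1+((z^2:ℝ):ℂ)*(k⁻¹)^2) := by field_simp
  have c2 : k^2-(z:ℂ)^2 = k^2*(1-(z:ℂ)^2*(k⁻¹)^2) := by field_simp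
  rw [c1, c2, neg_mul_eq_mul_neg, mul_div_mul_left _ _ (pow_ne_zero 2 hm2)]

end ZS
end

section
open Filter Topology Finset
namespace ZS

noncomputable def pk (Y : ℝ) : ℕ → ℝ
  | 0 => 1
  | k+1 => ((((k:ℝ)+1)^2+Y)/(((k:ℝ)+1)^2-Y)) / pk Y k

noncomputable def PP (Y : ℝ) (k : ℕ) : ℝ := pk Y k + 1/pk Y k
noncomputable def QQ (Y : ℝ) (k : ℕ) : ℝ := Y*(pk Y k - 1/pk Y k)
noncomputable def gam (Y : ℝ) (k : ℕ) : ℝ := (PP Y (k+1) + PP Y k)/2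
noncomputable def alp (Y : ℝ) (k : ℕ) : ℝ := (PP Y (k+1) - PP Y k)/2
noncomputable def uu (N : ℝ) (k : ℕ) : ℝ := ∏ i ∈ range k, (N-i)/(N+i+1)

lemma sq_sub_pos {Y : ℝ} (hY1 : Y < 1) (k : ℕ) : 0 < ((k:ℝ)+1)^2-Y := by
  have : (0:ℝ) ≤ k := k.cast_nonneg
  nlinarith

lemma pk_pos {Y : ℝ} (hY : 0 < Y) (hY1 : Y < 1) (k : ℕ) : 0 < pk Y k := by
  induction k with
  | zero => simp [pk]
  | succ k ih => 
    have := sq_sub_pos hY1 k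
    unfold pk; positivity

lemma PP_pos {Y : ℝ} (hY : 0 < Y) (hY1 : Y < 1) (k : ℕ) : 0 < PP Y k := by
  have := pk_pos hY hY1 k
  unfold PP; positivity
lemma gam_pos {Y : ℝ} (hY : 0 < Y) (hY1 : Y < 1) (k : ℕ) : 0 < gam Y k := by
  have := PP_pos hY hY1 k
  have := PP_pos hY hY1 (k+1)
  unfold gam; positivity

lemma gam_eq {Y : ℝ} (hY : 0 < Y) (hY1 : Y < 1) (k : ℕ) :
    Y^2*gam Y k = ((k:ℝ)+1)^2 * ((QQ Y (k+1) + QQ Y k)/2) := by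
  have h := pk_pos hY hY1 k
  have h1 := sq_sub_pos hY1 k
  have h2 : 0 < ((k:ℝ)+1)^2+Y := by positivity
  unfold gam PP QQ
  simp only [pk]
  field_simp
  ring

lemma alp_eq {Y : ℝ} (hY : 0 < Y) (hY1 : Y < 1) (k : ℕ) :
    ((k:ℝ)+1)^2*alp Y k = (QQ Y (k+1) - QQ Y k)/2 := by
  have h := pk_pos hY hY1 k
  have h1 := sq_sub_pos hY1 k
  have h2 : 0 < ((k:ℝ)+1)^2+Y := by positivity
  unfold alp PP QQ
  simp only [pk]
  field_simp
  ring

lemma gam_q {Y : ℝ} (hY : 0 < Y) (hY1 : Y < 1) (k : ℕ) :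
    gam Y k = ((k:ℝ)+1)^2*(pk Y k/(((k:ℝ)+1)^2+Y) + (pk Y k)⁻¹/(((k:ℝ)+1)^2-Y)) := by
  have h := pk_pos hY hY1 k
  have h1 := sq_sub_pos hY1 k
  have h2 : 0 < ((k:ℝ)+1)^2+Y := by positivity
  unfold gam PP
  simp only [pk]
  field_simp
  ring

lemma gam_q' {Y : ℝ} (hY : 0 < Y) (hY1 : Y < 1) (k : ℕ) :
    gam Y k = ((k:ℝ)+1)^2*(pk Y (k+1)/(((k:ℝ)+1)^2+Y) + (pk Y (k+1))⁻¹/(((k:ℝ)+1)^2-Y)) := by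
  have h := pk_pos hY hY1 k
  have h1 := sq_sub_pos hY1 k
  have h2 : 0 < ((k:ℝ)+1)^2+Y := by positivity
  unfold gam PP
  simp only [pk]
  field_simp
  ring

lemma uu_succ (N : ℕ) (k : ℕ) : uu N (k+1) * (N+k+1) = uu N k * (N-k) := by
  unfold uu
  rw [prod_range_succ]
  have : (N:ℝ)+k+1 ≠ 0 := by positivity
  field_simp

lemma uu_zero (N : ℕ) (k : ℕ) (h : N < k) : uu N k = 0 := by
  unfold uu
  apply prod_eq_zero (mem_range.2 h)
  simp

lemma uu_nonneg (N k : ℕ) : 0 ≤ uu N k := by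
  rcases lt_or_ge N k with h | h
  · rw [uu_zero N k h]
  · apply prod_nonneg
    intro i hi
    rw [mem_range] at hi
    have : (i:ℝ) ≤ N := by exact_mod_cast (hi.le.trans h)
    have : (0:ℝ) ≤ (N:ℝ)-i := by linarith
    positivity

lemma uu_le (N k : ℕ) : uu N k ≤ 1 := by
  induction k with
  | zero => simp [uu]
  | succ k ih =>
    have h0 := uu_nonneg N k
    have h1 := uu_nonneg N (k+1)
    have h := uu_succ N k
    have : (0:ℝ) ≤ k := k.cast_nonneg
    have : (0:ℝ) ≤ N := N.cast_nonneg
    by_contra hc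
    push Not at hc
    nlinarith

lemma uu_pred (N k : ℕ) : ((N:ℝ)+1)^2 * uu N k = (((N:ℝ)+1)^2-(k:ℝ)^2) * uu ((N+1:ℕ):ℝ) k := by
  induction k with
  | zero => simp [uu]
  | succ k ih =>
    unfold uu at *
    rw [prod_range_succ, prod_range_succ]
    have h1 : (N:ℝ)+k+1 ≠ 0 := by positivity
    have h2 : ((N+1:ℕ):ℝ)+k+1 ≠ 0 := by positivity
    rw [← mul_assoc, ih]
    push_cast at *
    field_simp
    ring

lemma uu_tendsto (k : ℕ) : Tendsto (fun N : ℕ => uu N k) atTop (𝓝 1) := by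
  unfold uu
  rw [show 𝓝 (1:ℝ) = 𝓝 (∏ i ∈ range k, (1:ℝ)) by simp]
  apply tendsto_finsetProd
  intro i _
  have h : Tendsto (fun N : ℕ => 1 - (2*(i:ℝ)+1)*(1/((N:ℝ)+i+1))) atTop (𝓝 (1-(2*(i:ℝ)+1)*0)) := by
    apply Tendsto.const_sub
    apply Tendsto.const_mul
    have := (tendsto_one_div_add_atTop_nhds_zero_nat (𝕜 := ℝ)).comp (tendsto_add_atTop_nat i)
    refine this.congr (fun N => ?_)
    simp
  simp only [mul_zero, sub_zero] at h
  refine h.congr (fun N => ?_)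
  have : (N:ℝ)+i+1 ≠ 0 := by positivity
  field_simp
  ring

lemma tele (P : ℕ → ℝ) (N L : ℕ) :
    ∑ k ∈ range L, (((k:ℝ)+1)*uu N (k+1)*((P (k+1)+P k)/2) - N*(uu N (k+1)*((P (k+1)-P k)/2)))
     = (P 0*N - P L * uu N L*(N-L))/2 := by
  induction L with
  | zero => simp [uu]
  | succ L ih =>
    rw [sum_range_succ, ih]
    have := uu_succ N L
    push_cast
    linear_combination (P L)/2 * this

noncomputable def AN (Y : ℝ) (N : ℕ) : ℝ := 1 + ∑ k ∈ range N, alp Y k * uu N (k+1)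
noncomputable def BN (Y : ℝ) (N : ℕ) : ℝ := ∑ k ∈ range N, gam Y k/((k:ℝ)+1) * uu N (k+1)
noncomputable def CN (Y : ℝ) (N : ℕ) : ℝ := ∑ k ∈ range N, gam Y k/((k:ℝ)+1)^3 * uu N (k+1)

lemma sum_diff (f : ℕ → ℝ) (N : ℕ) :
    ∑ k ∈ range (N+1), f k * uu ((N+1:ℕ):ℝ) (k+1) - ∑ k ∈ range N, f k * uu N (k+1) =
    ∑ k ∈ range (N+1), (f k * ((k:ℝ)+1)^2)* uu ((N+1:ℕ):ℝ) (k+1) / ((N:ℝ)+1)^2 := by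
  have : ∑ k ∈ range N, f k * uu N (k+1) = ∑ k ∈ range (N+1), f k * uu N (k+1) := by
    rw [sum_range_succ, uu_zero N (N+1) (by omega)]; simp
  rw [this, ← sum_sub_distrib]
  refine sum_congr rfl (fun k _ => ?_)
  have := uu_pred N (k+1)
  have h : (N:ℝ)+1 ≠ 0 := by positivity
  field_simp
  push_cast at *
  linear_combination -f k * this

lemma CN_diff (Y : ℝ) (N : ℕ) : CN Y (N+1) - CN Y N = BN Y (N+1)/((N:ℝ)+1)^2 := by
  unfold CN BN
  rw [sum_diff, sum_div]
  refine sum_congr rfl (fun k _ => ?_)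
  have : (k:ℝ)+1 ≠ 0 := by positivity
  field_simp

lemma BN_diff (Y : ℝ) (N : ℕ) : BN Y (N+1) - BN Y N = AN Y (N+1)/((N:ℝ)+1) := by
  unfold BN AN
  rw [sum_diff, ← sum_div]
  have := tele (PP Y) (N+1) (N+1)
  rw [sum_sub_distrib, ← mul_sum] at this
  have h : (N:ℝ)+1 ≠ 0 := by positivity
  have e0 : PP Y 0 = 2 := by simp [PP, pk]; norm_num
  rw [e0] at this
  have e1 : ∑ k ∈ range (N+1), gam Y k/((k:ℝ)+1)*((k:ℝ)+1)^2* uu ((N+1:ℕ):ℝ) (k+1) =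
     ∑ k ∈ range (N+1), ((k:ℝ)+1)*uu ((N+1:ℕ):ℝ) (k+1)*((PP Y (k+1)+PP Y k)/2) := by
    refine sum_congr rfl (fun k _ => ?_)
    have : (k:ℝ)+1 ≠ 0 := by positivity
    unfold gam
    field_simp
  have e2 : ∑ k ∈ range (N+1), alp Y k * uu ((N+1:ℕ):ℝ) (k+1) =
     ∑ k ∈ range (N+1), uu ((N+1:ℕ):ℝ) (k+1)*((PP Y (k+1)-PP Y k)/2) := by
    refine sum_congr rfl (fun k _ => ?_)
    unfold alp
    ring
  rw [e1, e2]
  clear e1 e2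
  push_cast at *
  generalize ∑ x ∈ range (N + 1), ((x:ℝ) + 1) * uu ((N:ℝ) + 1) (x + 1) * ((PP Y (x + 1) + PP Y x) / 2) = S1 at this ⊢
  generalize ∑ x ∈ range (N + 1), uu ((N:ℝ) + 1) (x + 1) * ((PP Y (x + 1) - PP Y x) / 2) = S2 at this ⊢
  field_simp
  linear_combination this

lemma AN_diff {Y : ℝ} (hY : 0 < Y) (hY1 : Y < 1) (N : ℕ) : 
    AN Y (N+1) - AN Y N = Y^2*BN Y (N+1)/((N:ℝ)+1)^3 := by
  unfold BN AN
  rw [add_sub_add_left_eq_sub, sum_diff, ← sum_div]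
  have := tele (QQ Y) (N+1) (N+1)
  rw [sum_sub_distrib, ← mul_sum] at this
  have h : (N:ℝ)+1 ≠ 0 := by positivity
  have e0 : QQ Y 0 = 0 := by simp [QQ, pk]
  rw [e0] at this
  have e1 : Y^2*∑ k ∈ range (N+1), gam Y k/((k:ℝ)+1)* uu ((N+1:ℕ):ℝ) (k+1) =
     ∑ k ∈ range (N+1), ((k:ℝ)+1)*uu ((N+1:ℕ):ℝ) (k+1)*((QQ Y (k+1)+QQ Y k)/2) := by
    rw [mul_sum]
    refine sum_congr rfl (fun k _ => ?_)
    have h : (k:ℝ)+1 ≠ 0 := by positivity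
    have := gam_eq hY hY1 k
    field_simp
    linear_combination uu ((N+1:ℕ):ℝ) (k+1) * this * 2
  have e2 : ∑ k ∈ range (N+1), alp Y k * ((k:ℝ)+1)^2* uu ((N+1:ℕ):ℝ) (k+1) =
     ∑ k ∈ range (N+1), uu ((N+1:ℕ):ℝ) (k+1)*((QQ Y (k+1)-QQ Y k)/2) := by
    refine sum_congr rfl (fun k _ => ?_)
    rw [← alp_eq hY hY1]
    ring
  rw [e1, e2]
  clear e1 e2
  push_cast at *
  generalize ∑ x ∈ range (N + 1), ((x:ℝ) + 1) * uu ((N:ℝ) + 1) (x + 1) * ((QQ Y (x + 1) + QQ Y x) / 2) = S1 at this ⊢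
  generalize ∑ x ∈ range (N + 1), uu ((N:ℝ) + 1) (x + 1) * ((QQ Y (x + 1) - QQ Y x) / 2) = S2 at this ⊢
  field_simp
  linear_combination -this
end ZS
end

section
open Filter Topology Finset
namespace ZS

noncomputable def aa : ℕ → ℕ → ℝ
  | 0, _ => 1
  | n+1, N => ∑ M ∈ range N, (∑ L ∈ range (M+1), aa n (L+1)/((L:ℝ)+1))/((M:ℝ)+1)^3
noncomputable def bb (n N : ℕ) : ℝ := ∑ L ∈ range N, aa n (L+1)/((L:ℝ)+1)

lemma aa_succ (n N : ℕ) : aa (n+1) N = ∑ M ∈ range N, bb n (M+1)/((M:ℝ)+1)^3 := rfl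

lemma aa_nonneg (n : ℕ) : ∀ N, 0 ≤ aa n N := by
  induction n with
  | zero => intro N; simp [aa]
  | succ n ih =>
    intro N
    rw [aa_succ]
    refine sum_nonneg (fun M _ => div_nonneg (sum_nonneg fun L _ => div_nonneg (ih _) (by positivity)) (by positivity))

lemma bb_nonneg (n N : ℕ) : 0 ≤ bb n N :=
  sum_nonneg fun L _ => div_nonneg (aa_nonneg n _) (by positivity)

lemma BN_nonneg {Y : ℝ} (hY : 0 < Y) (hY1 : Y < 1) (N : ℕ) : 0 ≤ BN Y N := by
  unfold BN
  refine sum_nonneg (fun k _ => ?_)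
  have := gam_pos hY hY1 k
  have := uu_nonneg N (k+1)
  positivity

lemma AN_nonneg {Y : ℝ} (hY : 0 < Y) (hY1 : Y < 1) (N : ℕ) : 0 ≤ AN Y N := by
  induction N with
  | zero => simp [AN]
  | succ N ih =>
    have := AN_diff hY hY1 N
    have h := BN_nonneg hY hY1 (N+1)
    have : 0 ≤ Y^2*BN Y (N+1)/((N:ℝ)+1)^3 := by positivity
    linarith

noncomputable def SA (w : ℝ) (m N : ℕ) : ℝ := ∑ n ∈ range m, w^n*aa n N
noncomputable def SB (w : ℝ) (m N : ℕ) : ℝ := ∑ n ∈ range m, w^n*bb n N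

lemma SA_diff (w : ℝ) (m N : ℕ) : SA w (m+1) (N+1) = SA w (m+1) N + w*SB w m (N+1)/((N:ℝ)+1)^3 := by
  unfold SA SB
  rw [sum_range_succ', sum_range_succ', mul_sum, sum_div]
  have : ∑ k ∈ range m, w^(k+1)*aa (k+1) (N+1) = ∑ k ∈ range m, w^(k+1)*aa (k+1) N
      + ∑ i ∈ range m, w*(w^i*bb i (N+1))/((N:ℝ)+1)^3 := by
    rw [← sum_add_distrib]
    refine sum_congr rfl (fun k _ => ?_)
    rw [aa_succ, aa_succ, sum_range_succ]
    ring
  rw [this]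
  simp only [aa]
  ring

lemma SB_diff (w : ℝ) (m N : ℕ) : SB w m (N+1) = SB w m N + SA w m (N+1)/((N:ℝ)+1) := by
  unfold SA SB
  rw [sum_div, ← sum_add_distrib]
  refine sum_congr rfl (fun k _ => ?_)
  unfold bb
  rw [sum_range_succ]
  ring

lemma SAB_le {Y : ℝ} (hY : 0 < Y) (hY1 : Y < 1) (N : ℕ) : 
    ∀ m, SA (Y^2) m N ≤ AN Y N ∧ SB (Y^2) m N ≤ BN Y N := by
  induction N with
  | zero =>
    intro m
    constructor
    · rcases m with _ | m
      · simp [SA, AN]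
      · simp [SA, AN, sum_range_succ', aa]
    · simp [SB, BN, bb]
  | succ N ih =>
    intro m
    induction m with
    | zero => simp [SA, SB, AN_nonneg hY hY1, BN_nonneg hY hY1]
    | succ m ihm =>
      have h1 : SA (Y^2) (m+1) (N+1) ≤ AN Y (N+1) := by
        have e := AN_diff hY hY1 N
        rw [SA_diff]
        have a := (ih (m+1)).1
        have b := ihm.2
        have : Y^2*SB (Y^2) m (N+1)/((N:ℝ)+1)^3 ≤ Y^2*BN Y (N+1)/((N:ℝ)+1)^3 := by gcongr
        linarith
      refine ⟨h1, ?_⟩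
      have e := BN_diff Y N
      rw [SB_diff]
      have a := (ih (m+1)).2
      have : SA (Y^2) (m+1) (N+1)/((N:ℝ)+1) ≤ AN Y (N+1)/((N:ℝ)+1) := by gcongr
      linarith

lemma A_summable {Y : ℝ} (hY : 0 < Y) (hY1 : Y < 1) (N : ℕ) : Summable (fun n => (Y^2)^n*aa n N) :=
  summable_of_sum_range_le (fun n => mul_nonneg (by positivity) (aa_nonneg _ _)) (fun m => (SAB_le hY hY1 N m).1)
lemma B_summable {Y : ℝ} (hY : 0 < Y) (hY1 : Y < 1) (N : ℕ) : Summable (fun n => (Y^2)^n*bb n N) :=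
  summable_of_sum_range_le (fun n => mul_nonneg (by positivity) (bb_nonneg _ _)) (fun m => (SAB_le hY hY1 N m).2)

lemma AB_tsum {Y : ℝ} (hY : 0 < Y) (hY1 : Y < 1) (N : ℕ) :
    ∑' n, (Y^2)^n*aa n N = AN Y N ∧ ∑' n, (Y^2)^n*bb n N = BN Y N := by
  have tA : ∀ N, Tendsto (fun m => SA (Y^2) m N) atTop (𝓝 (∑' n, (Y^2)^n*aa n N)) := fun N =>
    (A_summable hY hY1 N).hasSum.tendsto_sum_nat
  have tB : ∀ N, Tendsto (fun m => SB (Y^2) m N) atTop (𝓝 (∑' n, (Y^2)^n*bb n N)) := fun N =>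
    (B_summable hY hY1 N).hasSum.tendsto_sum_nat
  induction N with
  | zero =>
    constructor
    · rw [(A_summable hY hY1 0).tsum_eq_zero_add]
      simp [aa, AN]
    · simp [bb, BN]
  | succ N ih =>
    have r1 := tendsto_nhds_unique ((tA (N+1)).comp (tendsto_add_atTop_nat 1))
      ((((tA N).comp (tendsto_add_atTop_nat 1)).add (((tB (N+1)).const_mul (Y^2)).div_const (((N:ℝ)+1)^3))).congr
        (fun m => (SA_diff (Y^2) m N).symm))
    have r2 := tendsto_nhds_unique (tB (N+1))
      (((tB N).add ((tA (N+1)).div_const ((N:ℝ)+1))).congr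
        (fun m => (SB_diff (Y^2) m N).symm))
    rw [ih.1] at r1
    rw [ih.2] at r2
    have e1 := AN_diff hY hY1 N
    have e2 := BN_diff Y N
    set X := ∑' n, (Y^2)^n*aa n (N+1)
    set Z := ∑' n, (Y^2)^n*bb n (N+1)
    have hN : (0:ℝ) < (N:ℝ)+1 := by positivity
    have f1 : X - AN Y (N+1) = Y^2*(Z-BN Y (N+1))/((N:ℝ)+1)^3 := by
      rw [r1]; linear_combination -e1
    have f2 : Z - BN Y (N+1) = (X-AN Y (N+1))/((N:ℝ)+1) := by
      rw [r2]; linear_combination -e2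
    have f3 : (Z - BN Y (N+1))*(((N:ℝ)+1)^4-Y^2) = 0 := by
      rw [f1] at f2
      field_simp at f2
      linear_combination f2
    have h4 : ((N:ℝ)+1)^4-Y^2 ≠ 0 := by
      have : (1:ℝ) ≤ ((N:ℝ)+1)^4 := one_le_pow₀ (by linarith [(N.cast_nonneg : (0:ℝ) ≤ N)])
      nlinarith
    have f4 : Z - BN Y (N+1) = 0 := (mul_eq_zero.1 f3).resolve_right h4
    rw [f4] at f1
    constructor
    · have : X - AN Y (N+1) = 0 := by rw [f1]; simp
      linarith
    · linarith

lemma CN_sum (Y : ℝ) (N : ℕ) : CN Y N = ∑ M ∈ range N, BN Y (M+1)/((M:ℝ)+1)^2 := by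
  induction N with
  | zero => simp [CN]
  | succ N ih => rw [sum_range_succ, ← ih, ← CN_diff]; ring

lemma CN_tendsto {Y : ℝ} (hY : 0 < Y) (hY1 : Y < 1) (C : ℝ) (hC : ∀ k, gam Y k ≤ C) :
    Tendsto (CN Y) atTop (𝓝 (∑' k, gam Y k/((k:ℝ)+1)^3)) := by
  have e : CN Y = fun N : ℕ => ∑' k, gam Y k/((k:ℝ)+1)^3 * uu N (k+1) := by
    funext N
    rw [tsum_eq_sum (s := range N)]
    · rfl
    · intro k hk
      rw [mem_range, not_lt] at hk
      rw [uu_zero N (k+1) (by omega), mul_zero]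
  rw [e]
  refine tendsto_tsum_of_dominated_convergence (bound := fun k : ℕ => C * (1/((k:ℝ)+1)^3)) ?_ ?_ ?_
  · apply Summable.mul_left
    have := (summable_nat_add_iff 1).2 (Real.summable_one_div_nat_pow.2 (by norm_num : 1 < 3))
    simpa using this
  · intro k
    have := (uu_tendsto (k+1)).const_mul (gam Y k/((k:ℝ)+1)^3)
    simpa using this
  · refine Eventually.of_forall (fun N k => ?_)
    have h1 := uu_nonneg N (k+1)
    have h2 := uu_le N (k+1)
    have h3 := gam_pos hY hY1 k
    rw [Real.norm_of_nonneg (by positivity)]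
    calc gam Y k/((k:ℝ)+1)^3 * uu N (k+1) ≤ gam Y k/((k:ℝ)+1)^3 * 1 := by gcongr
      _ ≤ C/((k:ℝ)+1)^3 * 1 := by gcongr; exact hC k
      _ = _ := by ring

noncomputable def zz (n : ℕ) : ℝ := ∑' M : ℕ, bb n (M+1)/((M:ℝ)+1)^2

theorem zz_hasSum {Y : ℝ} (hY : 0 < Y) (hY1 : Y < 1) (C : ℝ) (hC : ∀ k, gam Y k ≤ C) :
    HasSum (fun n => (Y^2)^n * zz n) (∑' k, gam Y k/((k:ℝ)+1)^3) ∧ 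
      ∀ n, Summable (fun M : ℕ => bb n (M+1)/((M:ℝ)+1)^2) := by
  set G := ∑' k, gam Y k/((k:ℝ)+1)^3
  have hM : HasSum (fun M : ℕ => BN Y (M+1)/((M:ℝ)+1)^2) G := by
    rw [hasSum_iff_tendsto_nat_of_nonneg]
    · exact (CN_tendsto hY hY1 C hC).congr (fun N => CN_sum Y N)
    · intro M
      have := BN_nonneg hY hY1 (M+1)
      positivity
  let f : ℕ × ℕ → ℝ := fun p => (Y^2)^p.2*bb p.2 (p.1+1)/((p.1:ℝ)+1)^2
  have hf0 : 0 ≤ f := fun p => div_nonneg (mul_nonneg (by positivity) (bb_nonneg _ _)) (by positivity)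
  have hfn : ∀ M, HasSum (fun n => f (M,n)) (BN Y (M+1)/((M:ℝ)+1)^2) := by
    intro M
    have := (B_summable hY hY1 (M+1)).hasSum
    rw [(AB_tsum hY hY1 (M+1)).2] at this
    exact this.div_const _
  have hf : Summable f := by
    rw [summable_prod_of_nonneg hf0]
    refine ⟨fun M => (hfn M).summable, ?_⟩
    refine hM.summable.congr (fun M => ?_)
    rw [(hfn M).tsum_eq]
  have hf' : Summable (fun p : ℕ × ℕ => f (p.2,p.1)) := hf.prod_symm
  have hs : ∀ n, Summable (fun M : ℕ => bb n (M+1)/((M:ℝ)+1)^2) := by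
    intro n
    have := (hf'.prod_factor n).mul_left (((Y^2)^n)⁻¹)
    refine this.congr (fun M => ?_)
    have : (Y^2)^n ≠ 0 := by positivity
    simp only [f]
    field_simp
  refine ⟨?_, hs⟩
  have h1 : HasSum f G := by
    have := hf.hasSum.prod_fiberwise hfn
    rw [hM.unique this]
    exact hf.hasSum
  have h2 : HasSum (fun p : ℕ × ℕ => f (p.2,p.1)) G := by
    have := (Equiv.prodComm ℕ ℕ).hasSum_iff.2 h1
    exact this
  refine (h2.prod_fiberwise (fun n => (hf'.prod_factor n).hasSum)).congr_fun ?_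
  intro n
  unfold zz
  rw [← tsum_mul_left]
  refine tsum_congr (fun M => ?_)
  simp only [f]
  ring
end ZS
end

section
open Filter Topology Finset
namespace ZS

lemma pk_eP (z : ℝ) (hz : 0 < z) (hz1 : z ≤ 1/4) (m : ℕ) :
    ((pk (z^2) (2*m) : ℝ):ℂ) = eP ((z^2:ℝ):ℂ) z m := by
  have hY : (0:ℝ) < z^2 := by positivity
  have hY1 : z^2 < 1 := by nlinarith
  induction m with
  | zero => simp [pk, eP]
  | succ m ih =>
    rw [eP_succ, ← ih]
    have e : pk (z^2) (2*(m+1)) = pk (z^2) (2*m) * (((((2*m:ℕ):ℝ)+2)^2+z^2)*((((2*m:ℕ):ℝ)+1)^2-z^2) /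
       (((((2*m:ℕ):ℝ)+2)^2-z^2)*((((2*m:ℕ):ℝ)+1)^2+z^2))) := by
      rw [show 2*(m+1) = 2*m+1+1 by ring]
      simp only [pk]
      have h := pk_pos hY hY1 (2*m)
      have h1 := sq_sub_pos hY1 (2*m)
      have h2 := sq_sub_pos hY1 (2*m+1)
      push_cast at *
      rw [show 2*(m:ℝ)+1+1 = 2*m+2 by ring] at *
      have h3 : 0 < (2*(m:ℝ)+1)^2+z^2 := by positivity
      field_simp
    rw [e]
    unfold st
    push_cast
    ring

lemma pk_even_lim (z : ℝ) (hz : 0 < z) (hz1 : z ≤ 1/4) :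
    Tendsto (fun m => pk (z^2) (2*m)) atTop (𝓝 (tau z)) := by
  have := eP_lim z hz hz1
  have h := (Complex.continuous_re.tendsto _).comp this
  simp only [Complex.ofReal_re] at h
  refine h.congr (fun m => ?_)
  simp only [Function.comp_apply]
  rw [← pk_eP z hz hz1, Complex.ofReal_re]

lemma PP_even_odd {Y : ℝ} (hY : 0 < Y) (hY1 : Y < 1) (k : ℕ) :
    PP Y (k+1) ≤ ((1+Y)/(1-Y)) * PP Y k := by
  have h := pk_pos hY hY1 k
  have h1 := sq_sub_pos hY1 k
  have h2 : 0 < ((k:ℝ)+1)^2+Y := by positivity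
  have h3 : (1:ℝ) ≤ ((k:ℝ)+1)^2 := one_le_pow₀ (by linarith [(k.cast_nonneg : (0:ℝ) ≤ k)])
  have a1 : (((k:ℝ)+1)^2+Y)/(((k:ℝ)+1)^2-Y) ≤ (1+Y)/(1-Y) := by
    rw [div_le_div_iff₀ h1 (by linarith)]
    nlinarith
  have a2 : 1/((((k:ℝ)+1)^2+Y)/(((k:ℝ)+1)^2-Y)) ≤ (1+Y)/(1-Y) := by
    rw [one_div_div, div_le_div_iff₀ h2 (by linarith)]
    nlinarith
  have e : PP Y (k+1) = ((((k:ℝ)+1)^2+Y)/(((k:ℝ)+1)^2-Y)) * (1/pk Y k) + 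
    (1/((((k:ℝ)+1)^2+Y)/(((k:ℝ)+1)^2-Y)))*pk Y k := by
    unfold PP
    simp only [pk]
    field_simp
  rw [e]
  unfold PP
  have : 0 < 1/pk Y k := by positivity
  nlinarith

lemma gam_bdd (z : ℝ) (hz : 0 < z) (hz1 : z ≤ 1/4) : ∃ C, ∀ k, gam (z^2) k ≤ C := by
  have hY : (0:ℝ) < z^2 := by positivity
  have hY1 : z^2 < 1 := by nlinarith
  have ht := tau_pos z hz hz1
  have t := pk_even_lim z hz hz1
  have t2 : Tendsto (fun m => PP (z^2) (2*m)) atTop (𝓝 (tau z + 1/tau z)) :=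
    t.add (tendsto_const_nhds.div t ht.ne')
  obtain ⟨D, hD⟩ := t2.bddAbove_range
  have hD' : ∀ m, PP (z^2) (2*m) ≤ D := fun m => hD ⟨m, rfl⟩
  have hr : 0 < (1+z^2)/(1-z^2) := div_pos (by linarith) (by linarith)
  set r := (1+z^2)/(1-z^2) with hrd
  have hD0 : 0 < D := (PP_pos hY hY1 (2*0)).trans_le (hD' 0)
  have hP : ∀ k, PP (z^2) k ≤ D + r*D := by
    intro k
    rcases Nat.even_or_odd' k with ⟨m, rfl | rfl⟩
    · have := hD' m
      have : 0 < r*D := by positivity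
      linarith
    · have h1 := PP_even_odd hY hY1 (2*m)
      have : r * PP (z^2) (2*m) ≤ r*D := by gcongr; exact hD' m
      linarith
  refine ⟨D+r*D, fun k => ?_⟩
  unfold gam
  linarith [hP k, hP (k+1)]

theorem G_eq_SS (z : ℝ) (hz : 0 < z) (hz1 : z ≤ 1/4) :
    ((∑' k, gam (z^2) k/((k:ℝ)+1)^3 : ℝ):ℂ) = SS ((z^2:ℝ):ℂ) z := by
  have hY : (0:ℝ) < z^2 := by positivity
  have hY1 : z^2 < 1 := by nlinarith
  have hg := good_z z hz hz1
  obtain ⟨C, hC⟩ := gam_bdd z hz hz1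
  have ht := tau_pos z hz hz1
  set Y := z^2 with hYd
  have hFP : ∀ m, FP (Y:ℂ) z m = ((pk Y (2*m) * (1/((2*m:ℕ)*(((2*m:ℕ):ℝ)^2+Y)) 
      + 1/((((2*m:ℕ):ℝ)+1)*((((2*m:ℕ):ℝ)+1)^2+Y))) : ℝ):ℂ) := by
    intro m
    unfold FP wt
    rw [← pk_eP z hz hz1]
    push_cast
    rfl
  have hFN : ∀ n, FN (Y:ℂ) z n = (((pk Y (2*n+2))⁻¹ * (1/((((2*n:ℕ):ℝ)+2)*((((2*n:ℕ):ℝ)+2)^2-Y)))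
      + (pk Y (2*n))⁻¹ * (1/((((2*n:ℕ):ℝ)+1)*((((2*n:ℕ):ℝ)+1)^2-Y))) : ℝ):ℂ) := by
    intro n
    have h := eN_eq z hz hz1 (n+1)
    rw [← pk_eP z hz hz1] at h
    have e0 : pk Y (2*n+2) = ((((2*n:ℕ):ℝ)+2)^2+Y)/((((2*n:ℕ):ℝ)+2)^2-Y)/(((((2*n:ℕ):ℝ)+1)^2+Y)/((((2*n:ℕ):ℝ)+1)^2-Y)/pk Y (2*n)) := by
      simp only [pk]
      push_cast
      rw [show 2*(n:ℝ)+1+1 = 2*n+2 by ring]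
    have p0 := pk_pos hY hY1 (2*n)
    have p1 := pk_pos hY hY1 (2*n+2)
    have h1 := sq_sub_pos hY1 (2*n)
    have h2 := sq_sub_pos hY1 (2*n+1)
    have h3 : 0 < (((2*n:ℕ):ℝ)+1)^2+Y := by positivity
    have h4 : 0 < (((2*n:ℕ):ℝ)+2)^2+Y := by positivity
    have e1 : eN (Y:ℂ) z (n+1) = ((-(pk Y (2*n+2))⁻¹ * (((((2*n:ℕ):ℝ)+2)^2+Y)/((((2*n:ℕ):ℝ)+2)^2-Y)) : ℝ):ℂ) := by
      have p1' : ((pk Y (2*n+2):ℝ):ℂ) ≠ 0 := by exact_mod_cast p1.ne'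
      apply mul_right_cancel₀ p1'
      rw [show 2*n+2 = 2*(n+1) by ring] at *
      rw [h]
      push_cast at *
      rw [mul_right_comm, neg_mul, inv_mul_cancel₀ p1', hYd]
      push_cast
      ring
    unfold FN wt
    rw [e1]
    rw [show -((2*n+2:ℕ):ℂ) = ((-(((2*n:ℕ):ℝ)+2):ℝ):ℂ) by push_cast; ring]
    rw [← Complex.ofReal_pow]
    norm_cast
    push_cast at *
    rw [show 2*(n:ℝ)+1+1 = 2*n+2 by ring] at *
    rw [e0]
    set k := 2*(n:ℝ)
    have hk : (0:ℝ) ≤ k := by positivity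
    have h5 : k+2 ≠ 0 := by positivity
    have h6 : k+1 ≠ 0 := by positivity
    have h7 : (-(k+2))^2+Y = (k+2)^2+Y := by ring
    have h8 : (-(k+2)+1) = -(k+1) := by ring
    have h9 : (-(k+1))^2+Y = (k+1)^2+Y := by ring
    rw [h7, h8, h9]
    field_simp
    ring
  have key : ∀ M, ∑ m ∈ range M, (FP (Y:ℂ) z m + FN (Y:ℂ) z m) = 
      ((∑ k ∈ range (2*M-1), gam Y k/((k:ℝ)+1)^3 + (pk Y (2*M))⁻¹ * (1/((2*M:ℕ)*(((2*M:ℕ):ℝ)^2-Y))) : ℝ):ℂ) := by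
    intro M
    induction M with
    | zero => simp
    | succ M ih =>
      rw [sum_range_succ, ih, hFP, hFN, ← Complex.ofReal_add, ← Complex.ofReal_add]
      congr 1
      have g1 := gam_q hY hY1 (2*M)
      have hpos : ∀ k:ℕ, gam Y k = gam Y k := fun _ => rfl
      have h1 := sq_sub_pos hY1 (2*M)
      rw [show 2*(M+1)-1 = 2*M+1 by omega, sum_range_succ, show 2*(M+1) = 2*M+2 by ring]
      have e1 : gam Y (2*M)/(((2*M:ℕ):ℝ)+1)^3 = pk Y (2*M) * (1/((((2*M:ℕ):ℝ)+1)*((((2*M:ℕ):ℝ)+1)^2+Y)))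
         + (pk Y (2*M))⁻¹*(1/((((2*M:ℕ):ℝ)+1)*((((2*M:ℕ):ℝ)+1)^2-Y))) := by
        rw [g1]
        have : (((2*M:ℕ):ℝ)+1)^2+Y ≠ 0 := by positivity
        have p0 := pk_pos hY hY1 (2*M)
        field_simp
      rw [e1]
      rcases M with _ | M
      · simp
        ring
      · rw [show 2*(M+1)-1 = 2*M+1 by omega, show 2*(M+1) = (2*M+1)+1 by ring, sum_range_succ _ (2*M+1)]
        have g2 := gam_q' hY hY1 (2*M+1)
        have e2 : gam Y (2*M+1)/(((2*M+1:ℕ):ℝ)+1)^3 = pk Y (2*M+1+1) * (1/((((2*M+1:ℕ):ℝ)+1)*((((2*M+1:ℕ):ℝ)+1)^2+Y)))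
         + (pk Y (2*M+1+1))⁻¹*(1/((((2*M+1:ℕ):ℝ)+1)*((((2*M+1:ℕ):ℝ)+1)^2-Y))) := by
          rw [g2]
          have h1 := sq_sub_pos hY1 (2*M+1)
          have : (((2*M+1:ℕ):ℝ)+1)^2+Y ≠ 0 := by positivity
          have p0 := pk_pos hY hY1 (2*M+1+1)
          field_simp
        rw [show (((2*M+1+1:ℕ)):ℝ) = ((2*M+1:ℕ):ℝ)+1 by push_cast; ring]
        rw [e2]
        rw [show (((2*M+1+1+2:ℕ)):ℝ) = ((2*M+1:ℕ):ℝ)+1+2 by push_cast; ring]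
        ring
  have s1 := FP_summable Y hY z hg 0
  have s2 := FN_summable Y hY hY1.le z hg 0
  simp only [Nat.cast_zero, mul_zero, add_zero] at s1 s2
  have t1 : Tendsto (fun M => ∑ m ∈ range M, (FP (Y:ℂ) z m + FN (Y:ℂ) z m)) atTop (𝓝 (SS (Y:ℂ) z)) :=
    (s1.hasSum.add s2.hasSum).tendsto_sum_nat
  have sg : Summable (fun k : ℕ => gam Y k/((k:ℝ)+1)^3) := by
    have := (summable_nat_add_iff 1).2 (Real.summable_one_div_nat_pow.2 (by norm_num : 1 < 3))
    refine Summable.of_nonneg_of_le (fun k => ?_) (fun k => ?_) (this.mul_left C)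
    · have := gam_pos hY hY1 k
      positivity
    · have := hC k
      push_cast
      rw [mul_one_div]
      gcongr
  have t2 : Tendsto (fun M => ∑ k ∈ range (2*M-1), gam Y k/((k:ℝ)+1)^3) atTop (𝓝 (∑' k, gam Y k/((k:ℝ)+1)^3)) := by
    refine sg.hasSum.tendsto_sum_nat.comp (tendsto_atTop_mono (fun M => ?_) tendsto_id (f := id))
    simp only [id]; omega
  have t3 : Tendsto (fun M : ℕ => 1/(((2*M:ℕ):ℝ)*(((2*M:ℕ):ℝ)^2-Y))) atTop (𝓝 0) := by
    refine squeeze_zero' (g := fun M : ℕ => 1/(M:ℝ)) ?_ ?_ tendsto_one_div_atTop_nhds_zero_nat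
    · filter_upwards [eventually_ge_atTop 1] with M hM
      have hM' : (1:ℝ) ≤ M := by exact_mod_cast hM
      have : 0 ≤ ((2*M:ℕ):ℝ)^2-Y := by push_cast; nlinarith
      positivity
    · filter_upwards [eventually_ge_atTop 1] with M hM
      have hM' : (1:ℝ) ≤ M := by exact_mod_cast hM
      have h : 1 ≤ ((2*M:ℕ):ℝ)^2-Y := by push_cast; nlinarith
      apply one_div_le_one_div_of_le (by linarith)
      have : (M:ℝ) ≤ ((2*M:ℕ):ℝ) := by push_cast; linarith
      nlinarith
  have t4 := t2.add (((pk_even_lim z hz hz1).inv₀ ht.ne').mul t3)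
  rw [mul_zero, add_zero] at t4
  have t5 := (Complex.continuous_ofReal.tendsto _).comp t4
  exact tendsto_nhds_unique t5 (t1.congr key)
end ZS
end

section
open Filter Topology Finset
namespace ZS
open scoped ENNReal

noncomputable def WW {d : ℕ} (s g : Fin d → ℕ) : ℝ≥0∞ := ∏ i, ENNReal.ofReal (1/(idxSeq g i : ℝ)^s i)
noncomputable def TT {d : ℕ} (s : Fin d → ℕ) (h : ℕ → ℝ≥0∞) : ℝ≥0∞ := ∑' g, WW s g * h (1+∑ i, g i)

lemma idx_snoc_cast {d : ℕ} (g : Fin d → ℕ) (m : ℕ) (i : Fin d) :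
    idxSeq (Fin.snoc g m : Fin (d+1) → ℕ) i.castSucc = idxSeq g i := by
  unfold idxSeq
  congr 1
  rw [sum_filter, sum_filter, Fin.sum_univ_castSucc]
  simp [Fin.snoc_castSucc]

lemma idx_snoc_last {d : ℕ} (g : Fin d → ℕ) (m : ℕ) :
    idxSeq (Fin.snoc g m : Fin (d+1) → ℕ) (Fin.last d) = 1 + (∑ i, g i + m) := by
  unfold idxSeq
  congr 1
  rw [sum_filter, Fin.sum_univ_castSucc]
  simp [Fin.snoc_castSucc, Fin.le_last]

lemma WW_snoc {d : ℕ} (s g : Fin d → ℕ) (t m : ℕ) :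
    WW (Fin.snoc s t : Fin (d+1) → ℕ) (Fin.snoc g m) = WW s g * ENNReal.ofReal (1/(((∑ i, g i + m:ℕ):ℝ)+1)^t) := by
  unfold WW
  rw [Fin.prod_univ_castSucc]
  simp only [idx_snoc_cast, idx_snoc_last, Fin.snoc_castSucc, Fin.snoc_last]
  rw [show ((1+(∑ i, g i + m):ℕ):ℝ) = ((∑ i, g i + m:ℕ):ℝ)+1 by push_cast; ring]

lemma tsum_shift (F : ℕ → ℝ≥0∞) (x : ℕ) : ∑' m, F (x+m) = ∑' L, if x ≤ L then F L else 0 := by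
  have := (add_right_injective x).tsum_eq (f := fun L => if x ≤ L then F L else 0) (by
    intro L hL
    simp only [Function.mem_support, ne_eq, ite_eq_right_iff, Classical.not_imp] at hL
    exact ⟨L-x, by simp only; omega⟩)
  rw [← this]
  simp

lemma TT_snoc {d : ℕ} (s : Fin d → ℕ) (t : ℕ) (h : ℕ → ℝ≥0∞) :
    TT (Fin.snoc s t : Fin (d+1) → ℕ) h = 
      ∑' L : ℕ, ENNReal.ofReal (1/((L:ℝ)+1)^t) * h (L+1) * TT s (fun x => if x ≤ L+1 then 1 else 0) := by
  unfold TT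
  rw [← (Fin.snocEquiv (fun _ : Fin (d+1) => ℕ)).tsum_eq, ENNReal.tsum_prod', ENNReal.tsum_comm]
  simp_rw [← ENNReal.tsum_mul_left]
  conv_rhs => rw [ENNReal.tsum_comm]
  refine tsum_congr (fun g => ?_)
  have e : ∀ m, WW (Fin.snoc s t : Fin (d+1) → ℕ) (Fin.snocEquiv (fun _ : Fin (d+1) => ℕ) (m, g)) *
      h (1+∑ i, (Fin.snocEquiv (fun _ : Fin (d+1) => ℕ) (m, g)) i) = 
      (fun L : ℕ => WW s g * (ENNReal.ofReal (1/((L:ℝ)+1)^t) * h (L+1))) (∑ i, g i + m) := by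
    intro m
    have : (Fin.snocEquiv (fun _ : Fin (d+1) => ℕ) (m, g)) = (Fin.snoc g m : Fin (d+1) → ℕ) := rfl
    rw [this, WW_snoc, Fin.sum_univ_castSucc]
    simp only [Fin.snoc_castSucc, Fin.snoc_last]
    rw [mul_assoc, add_comm 1]
  rw [tsum_congr e]
  refine (tsum_shift (fun L : ℕ => WW s g * (ENNReal.ofReal (1/((L:ℝ)+1)^t) * h (L+1))) (∑ i, g i)).trans ?_
  refine tsum_congr (fun L => ?_)
  have : (1 + ∑ i, g i ≤ L+1) ↔ ∑ i, g i ≤ L := by omega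
  simp only [this]
  split_ifs
  · ring
  · simp

noncomputable def cN {d : ℕ} (s : Fin d → ℕ) (N : ℕ) : ℝ≥0∞ := TT s (fun x => if x ≤ N then 1 else 0)

lemma cN_snoc {d : ℕ} (s : Fin d → ℕ) (t N : ℕ) :
    cN (Fin.snoc s t : Fin (d+1) → ℕ) N = ∑ L ∈ range N, ENNReal.ofReal (1/((L:ℝ)+1)^t) * cN s (L+1) := by
  unfold cN
  rw [TT_snoc, tsum_eq_sum (s := range N)]
  · refine sum_congr rfl (fun L hL => ?_)
    rw [mem_range] at hL
    rw [if_pos (by omega), mul_one]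
  · intro L hL
    rw [mem_range] at hL
    rw [if_neg (by omega), mul_zero, zero_mul]

lemma pat13_succ (n : ℕ) : pat13 (n+1) = (Fin.snoc (Fin.snoc (pat13 n) 1 : Fin (2*n+1) → ℕ) 3 : Fin (2*n+1+1) → ℕ) := by
  funext i
  change Fin (2*n+1+1) at i
  refine Fin.lastCases ?_ (fun i => ?_) i
  · rw [Fin.snoc_last]
    unfold pat13
    have : (Fin.last (2*n+1) : ℕ) % 2 ≠ 0 := by simp
    exact if_neg this
  · rw [Fin.snoc_castSucc]
    refine Fin.lastCases ?_ (fun i => ?_) i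
    · rw [Fin.snoc_last]
      unfold pat13
      have : ((Fin.last (2*n)).castSucc : ℕ) % 2 = 0 := by simp
      exact if_pos this
    · rw [Fin.snoc_castSucc]
      unfold pat13
      rfl

lemma cN_step {d : ℕ} (s : Fin d → ℕ) (t : ℕ) (f : ℕ → ℝ) (hf : ∀ N, 0 ≤ f N)
    (h : ∀ N, cN s (N+1) = ENNReal.ofReal (f (N+1))) (N : ℕ) :
    cN (Fin.snoc s t : Fin (d+1) → ℕ) N = ENNReal.ofReal (∑ L ∈ range N, f (L+1)/((L:ℝ)+1)^t) := by
  rw [cN_snoc, ENNReal.ofReal_sum_of_nonneg (fun L _ => div_nonneg (hf _) (by positivity))]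
  refine sum_congr rfl (fun L _ => ?_)
  rw [h, ← ENNReal.ofReal_mul (by positivity)]
  congr 1
  ring

lemma cN_pat (n : ℕ) : ∀ N, cN (pat13 n) (N+1) = ENNReal.ofReal (aa n (N+1)) := by
  induction n with
  | zero =>
    intro N
    unfold cN TT
    have : Subsingleton (Fin (2*0) → ℕ) := (Pi.uniqueOfIsEmpty (α := Fin 0) (fun _ => ℕ)).instSubsingleton
    rw [tsum_eq_single (fun _ => 0) (fun b hb => absurd (Subsingleton.elim _ _) hb)]
    simp [WW, aa]
  | succ n ih =>
    intro N
    rw [pat13_succ]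
    have h1 := cN_step (pat13 n) 1 (aa n) (aa_nonneg n) ih
    have h2 := cN_step (Fin.snoc (pat13 n) 1 : Fin (2*n+1) → ℕ) 3 (bb n) (bb_nonneg n) (fun N => by
      rw [h1]; simp only [pow_one]; rfl)
    refine (h2 (N+1)).trans ?_
    rw [aa_succ]

theorem zetaStar_zz (n : ℕ) : 
    zetaStar (Fin.snoc (Fin.snoc (pat13 n) 1 : Fin (2*n+1) → ℕ) 2 : Fin (2*n+1+1) → ℕ) = zz n := by
  have h1 := cN_step (pat13 n) 1 (aa n) (aa_nonneg n) (cN_pat n)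
  have e : zetaStar (Fin.snoc (Fin.snoc (pat13 n) 1 : Fin (2*n+1) → ℕ) 2 : Fin (2*n+1+1) → ℕ) = 
     (TT (Fin.snoc (Fin.snoc (pat13 n) 1 : Fin (2*n+1) → ℕ) 2 : Fin (2*n+1+1) → ℕ) (fun _ => 1)).toReal := by
    unfold TT zetaStar
    rw [ENNReal.tsum_toReal_eq]
    · refine tsum_congr (fun g => ?_)
      rw [mul_one]
      unfold WW
      rw [ENNReal.toReal_prod]
      refine prod_congr rfl (fun i _ => ?_)
      rw [ENNReal.toReal_ofReal (by positivity)]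
    · intro g
      rw [mul_one]
      unfold WW
      exact ENNReal.prod_ne_top (fun i _ => ENNReal.ofReal_ne_top)
  rw [e, TT_snoc, ENNReal.tsum_toReal_eq]
  · unfold zz
    refine tsum_congr (fun L => ?_)
    have := h1 (L+1)
    unfold cN at this
    rw [this, mul_one, ← ENNReal.ofReal_mul (by positivity), ENNReal.toReal_ofReal]
    · unfold bb
      simp only [pow_one]
      ring
    · refine mul_nonneg (by positivity) (sum_nonneg fun i _ => div_nonneg (aa_nonneg _ _) (by positivity))
  · intro L
    have := h1 (L+1)
    unfold cN at this
    rw [this, mul_one]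
    exact ENNReal.mul_ne_top ENNReal.ofReal_ne_top ENNReal.ofReal_ne_top

end ZS
end

section
open Filter Topology Finset
namespace ZS

lemma zeta_shift (k : ℕ) (hk : 1 < k) : HasSum (fun j : ℕ => 1/((j:ℂ)+1)^k) (riemannZeta k) := by
  have h : Summable (fun n : ℕ => 1/(n:ℂ)^k) := by
    rw [← summable_norm_iff]
    simpa using Real.summable_one_div_nat_pow.2 hk
  have h2 := (hasSum_nat_add_iff' 1).2 h.hasSum
  rw [← zeta_nat_eq_tsum_of_gt_one hk] at h2
  have hk0 : k ≠ 0 := by omega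
  simpa [hk0] using h2

noncomputable def zf (q p : ℕ) (v : ℂ) (x : ℕ × ℕ) : ℂ := (1/((x.1:ℂ)+1)^p) * (v/((x.1:ℂ)+1)^q)^x.2

lemma norm_succ (j : ℕ) : ‖(j:ℂ)+1‖ = (j:ℝ)+1 := by
  rw [← Nat.cast_one, ← Nat.cast_add, Complex.norm_natCast]; push_cast; ring

lemma zf_ratio (q : ℕ) (v : ℂ) (j : ℕ) : ‖v/((j:ℂ)+1)^q‖ ≤ ‖v‖ := by
  rw [norm_div, norm_pow, norm_succ]
  exact div_le_self (norm_nonneg _) (one_le_pow₀ (by linarith [(j.cast_nonneg : (0:ℝ) ≤ j)]))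

lemma zf_summable (q p : ℕ) (hp : 1 < p) (v : ℂ) (hv : ‖v‖ < 1) : Summable (zf q p v) := by
  have s1 : Summable (fun j : ℕ => 1/((j:ℝ)+1)^p) := by
    simpa using (summable_nat_add_iff 1).2 (Real.summable_one_div_nat_pow.2 hp)
  have s2 := summable_geometric_of_lt_one (norm_nonneg v) hv
  have s3 : Summable (fun x : ℕ × ℕ => (1/((x.1:ℝ)+1)^p) * ‖v‖^x.2) :=
    s1.mul_of_nonneg s2 (fun j => by positivity) (fun n => by positivity)
  refine Summable.of_norm_bounded s3 ?_
  rintro ⟨j, n⟩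
  have : ‖zf q p v (j,n)‖ = (1/((j:ℝ)+1)^p) * ‖v/((j:ℂ)+1)^q‖^n := by
    unfold zf
    rw [norm_mul, norm_div, norm_one, norm_pow, norm_succ, norm_pow]
  rw [this]
  exact mul_le_mul_of_nonneg_left (pow_le_pow_left₀ (norm_nonneg _) (zf_ratio q v j) n) (by positivity)

lemma zf_col (q p : ℕ) (hp : 1 < p) (v : ℂ) (n : ℕ) :
    HasSum (fun j : ℕ => zf q p v (j,n)) (riemannZeta ((q*n+p:ℕ):ℂ) * v^n) := by
  have h4 := (zeta_shift (q*n+p) (lt_of_lt_of_le hp (Nat.le_add_left _ _))).mul_right (v^n)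
  have h5 : (fun j : ℕ => zf q p v (j,n)) = fun j : ℕ => 1/((j:ℂ)+1)^(q*n+p) * v^n := by
    funext j
    have : (j:ℂ)+1 ≠ 0 := by exact_mod_cast j.succ_ne_zero
    simp only [zf]
    rw [div_pow, ← pow_mul, pow_add]
    field_simp
  rw [h5]
  exact h4

lemma zf_row (q p : ℕ) (v : ℂ) (hv : ‖v‖ < 1) (j : ℕ) :
    HasSum (fun n => zf q p v (j,n)) ((1/((j:ℂ)+1)^p) * (1 - v/((j:ℂ)+1)^q)⁻¹) := by
  have h1 : ‖v/((j:ℂ)+1)^q‖ < 1 := lt_of_le_of_lt (zf_ratio q v j) hv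
  simp only [zf]
  generalize v/((j:ℂ)+1)^q = r at *
  generalize 1/((j:ℂ)+1)^p = c
  have h2 := hasSum_geometric_of_norm_lt_one h1
  exact HasSum.mul_left c h2

lemma zser (q p : ℕ) (hp : 1 < p) (v : ℂ) (hv : ‖v‖ < 1) :
    HasSum (fun n : ℕ => riemannZeta ((q*n+p:ℕ):ℂ) * v^n)
      (∑' j : ℕ, (1/((j:ℂ)+1)^p) * (1 - v/((j:ℂ)+1)^q)⁻¹) := by
  have hs := zf_summable q p hp v hv
  rw [(hs.hasSum.prod_fiberwise (zf_row q p v hv)).tsum_eq]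
  have h3 : HasSum (fun x : ℕ × ℕ => zf q p v (x.2,x.1)) (∑' x, zf q p v x) :=
    (Equiv.prodComm ℕ ℕ).hasSum_iff.2 hs.hasSum
  exact HasSum.prod_fiberwise h3 (zf_col q p hp v)

lemma Zf_hasSum (v : ℂ) (hv : ‖v‖ < 1) :
    HasSum (fun n : ℕ => riemannZeta (4*n+3) * v^n) (Zf v) := by
  have h := zser 4 3 (by norm_num) v hv
  have e : Zf v = ∑' j : ℕ, (1/((j:ℂ)+1)^3) * (1 - v/((j:ℂ)+1)^4)⁻¹ := by
    unfold Zf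
    rw [(dZ_summable v hv).tsum_eq_zero_add]
    simp only [dZ, Nat.cast_zero, zero_div, zero_add]
    refine tsum_congr (fun j => ?_)
    have : (j:ℂ)+1 ≠ 0 := by exact_mod_cast j.succ_ne_zero
    have h2 : 1 - v/((j:ℂ)+1)^4 = (((j:ℂ)+1)^4 - v)/((j:ℂ)+1)^4 := by field_simp
    rw [h2, inv_div]
    push_cast
    field_simp
  rw [e]
  push_cast at h
  exact h

noncomputable def phi (x : ℂ) : ℂ := ∑' a : ℕ, riemannZeta (2*a) * (x^2)^a

lemma phi_summable (x : ℂ) (hx : ‖x‖ < 1) : Summable (fun a : ℕ => riemannZeta (2*a) * (x^2)^a) := by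
  rw [← summable_nat_add_iff 1]
  have h := (zser 2 2 (by norm_num) (x^2) (by rw [norm_pow]; exact pow_lt_one₀ (norm_nonneg _) hx (by norm_num))).summable.mul_right (x^2)
  refine h.congr (fun n => ?_)
  push_cast
  rw [pow_succ, mul_add, mul_one]
  ring

lemma phi_eq (x : ℂ) (hx : NI x) (hx1 : ‖x‖ < 1) :
    phi x = -(Real.pi*x/2)*Complex.cot (Real.pi*x) := by
  have hmem : x ∈ Complex.integerComplement := by
    rintro ⟨n, hn⟩
    exact hx n hn.symm
  have h := zser 2 2 (by norm_num) (x^2) (by rw [norm_pow]; exact pow_lt_one₀ (norm_nonneg _) hx1 (by norm_num))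
  have hc := cot_series_rep' hmem
  have hx0 := hx.ne
  have e1 : ∀ n : ℕ, (1 / (x - (n + 1)) + 1 / (x + (n + 1))) = 
      (-2*x) * ((1/((n:ℂ)+1)^2) * (1 - x^2/((n:ℂ)+1)^2)⁻¹) := by
    intro n
    have hn : (n:ℂ)+1 ≠ 0 := by exact_mod_cast n.succ_ne_zero
    have a1 : x - (n+1) ≠ 0 := by
      have := hx.add (-((n:ℤ)+1)); push_cast at this; rwa [← sub_eq_add_neg] at this
    have a2 : x + (n+1) ≠ 0 := by
      have := hx.add ((n:ℤ)+1); push_cast at this; exact this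
    have h2 : 1 - x^2/((n:ℂ)+1)^2 = -((x-(n+1))*(x+(n+1)))/((n:ℂ)+1)^2 := by field_simp; ring
    rw [h2, inv_div]
    field_simp
    ring
  rw [tsum_congr e1, tsum_mul_left, ← h.tsum_eq] at hc
  unfold phi
  rw [(phi_summable x hx1).tsum_eq_zero_add]
  have e2 : ∑' b : ℕ, riemannZeta (2*((b+1:ℕ):ℂ)) * (x^2)^(b+1) = 
      (∑' n : ℕ, riemannZeta ((2*n+2:ℕ):ℂ)*(x^2)^n)*x^2 := by
    rw [← tsum_mul_right]
    refine tsum_congr (fun n => ?_)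
    push_cast
    rw [pow_succ, mul_add, mul_one]
    ring
  rw [e2]
  simp only [Nat.cast_zero, mul_zero, riemannZeta_zero, pow_zero, mul_one]
  set S := ∑' n : ℕ, riemannZeta ((2*n+2:ℕ):ℂ)*(x^2)^n
  have : Real.pi*x*Complex.cot (Real.pi*x) = 1 + x*(-2*x*S) := by
    rw [← hc]; field_simp; ring
  linear_combination (1/2)*this

lemma phi_neg (x : ℂ) : phi (-x) = phi x := by simp [phi]
end ZS
end

section
open Filter Topology Finset
namespace ZS

lemma hasSum_cauchy {c d : ℕ → ℂ} {y S T : ℂ} (hc : HasSum (fun n => c n * y^n) S)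
    (hd : HasSum (fun n => d n * y^n) T) :
    HasSum (fun n => (∑ p ∈ antidiagonal n, c p.1 * d p.2) * y^n) (S*T) := by
  have n1 := hc.summable.norm
  have n2 := hd.summable.norm
  have e : ∀ n, ∑ p ∈ antidiagonal n, (c p.1 * y^p.1) * (d p.2*y^p.2) =
     (∑ p ∈ antidiagonal n, c p.1 * d p.2) * y^n := by
    intro n
    rw [sum_mul]
    refine sum_congr rfl (fun p hp => ?_)
    rw [← mem_antidiagonal.1 hp, pow_add]
    ring
  have h1 := (summable_norm_sum_mul_antidiagonal_of_summable_norm n1 n2).of_norm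
  have h2 := tsum_mul_tsum_eq_tsum_sum_antidiagonal_of_summable_norm n1 n2
  rw [hc.tsum_eq, hd.tsum_eq] at h2
  rw [h2]
  have h3 := h1.hasSum
  simp only [e] at h3 ⊢
  exact h3

noncomputable def cA (a : ℕ) : ℂ := (-1)^a*(1-2^(2*a))/4^a*riemannZeta (2*a)
noncomputable def cB (b : ℕ) : ℂ := 1/4^b*riemannZeta (2*b)
noncomputable def DA (m : ℕ) : ℂ := ∑ p ∈ antidiagonal m, cA p.1 * cB p.2

lemma cA_hasSum (x : ℂ) (hx : ‖x‖ < 1) :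
    HasSum (fun a => cA a * (x^2)^a) (phi (x*Complex.I/2) - phi (x*Complex.I)) := by
  have h1 := (phi_summable (x*Complex.I/2) (by simp; linarith [norm_nonneg x])).hasSum
  have h2 := (phi_summable (x*Complex.I) (by simpa)).hasSum
  have h3 := h1.sub h2
  have e : (fun a => cA a * (x^2)^a) = fun a : ℕ => riemannZeta (2*a)*((x*Complex.I/2)^2)^a -
      riemannZeta (2*a)*((x*Complex.I)^2)^a := by
    funext a
    have e1 : (x*Complex.I/2)^2 = (-1)*x^2/4 := by
      rw [div_pow, mul_pow, Complex.I_sq]; ring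
    have e2 : (x*Complex.I)^2 = (-1)*x^2 := by
      rw [mul_pow, Complex.I_sq]; ring
    rw [e1, e2, div_pow, mul_pow]
    unfold cA
    rw [pow_mul, show (2:ℂ)^2 = 4 by norm_num]
    have : (4:ℂ)^a ≠ 0 := pow_ne_zero _ (by norm_num)
    field_simp
  rw [e]
  exact h3

lemma cB_hasSum (x : ℂ) (hx : ‖x‖ < 1) :
    HasSum (fun a => cB a * (x^2)^a) (phi (x/2)) := by
  have h1 := (phi_summable (x/2) (by simp; linarith [norm_nonneg x])).hasSum
  have e : (fun a => cB a * (x^2)^a) = fun a : ℕ => riemannZeta (2*a)*((x/2)^2)^a := by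
    funext a
    rw [div_pow, div_pow, show (2:ℂ)^2 = 4 by norm_num]
    unfold cB
    ring
  rw [e]
  exact h1

lemma DA_hasSum (x : ℂ) (hx : ‖x‖ < 1) :
    HasSum (fun a => DA a * (x^2)^a) ((phi (x*Complex.I/2) - phi (x*Complex.I)) * phi (x/2)) :=
  hasSum_cauchy (cA_hasSum x hx) (cB_hasSum x hx)

lemma phi_vals (z : ℝ) (hz : 0 < z) (hz1 : z ≤ 1/4) :
    phi ((z:ℂ)*Complex.I/2) = -(((Real.pi*z/2/2:ℝ)):ℂ) * (Real.cosh (Real.pi*z/2)/Real.sinh (Real.pi*z/2)) ∧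
    phi ((z:ℂ)*Complex.I) = -(((Real.pi*z/2:ℝ)):ℂ) * (Real.cosh (2*(Real.pi*z/2))/Real.sinh (2*(Real.pi*z/2))) ∧
    phi ((z:ℂ)/2) = -(((Real.pi*z/2/2:ℝ)):ℂ) * (Real.cos (Real.pi*z/2)/Real.sin (Real.pi*z/2)) ∧
    phi (z:ℂ) = -(((Real.pi*z/2:ℝ)):ℂ) * (Real.cos (2*(Real.pi*z/2))/Real.sin (2*(Real.pi*z/2))) := by
  have nz : ‖(z:ℂ)‖ = z := by rw [Complex.norm_real, Real.norm_of_nonneg hz.le]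
  have hI : ∀ r : ℝ, 0 < r → NI ((r:ℂ)*Complex.I) := fun r hr => NI_of_im (by simp [hr.ne'])
  have c1 : ∀ r : ℝ, 0 < r → r < 1 → phi ((r:ℂ)*Complex.I) = -((Real.pi*r/2:ℝ):ℂ) * (Real.cosh (Real.pi*r)/Real.sinh (Real.pi*r)) := by
    intro r hr hr1
    rw [phi_eq _ (hI r hr) (by simp [abs_of_pos hr, hr1]), Complex.cot, ← mul_assoc, Complex.cos_mul_I, Complex.sin_mul_I]
    have hs : Real.sinh (Real.pi*r) ≠ 0 := by
      have : 0 < Real.sinh (Real.pi*r) := Real.sinh_pos_iff.2 (by positivity)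
      exact this.ne'
    have hs' : Complex.sinh ((Real.pi:ℂ)*r) ≠ 0 := by
      rw [← Complex.ofReal_mul, ← Complex.ofReal_sinh]; exact_mod_cast hs
    push_cast
    field_simp
  have c2 : ∀ r : ℝ, 0 < r → r < 1 → phi (r:ℂ) = -((Real.pi*r/2:ℝ):ℂ) * (Real.cos (Real.pi*r)/Real.sin (Real.pi*r)) := by
    intro r hr hr1
    rw [phi_eq _ (NI_of_re (by simpa) (by simpa)) (by simp [abs_of_pos hr, hr1]), Complex.cot]
    push_cast
    rfl
  have a1 := c1 (z/2) (by positivity) (by linarith)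
  have a2 := c1 z hz (by linarith)
  have a3 := c2 (z/2) (by positivity) (by linarith)
  have a4 := c2 z hz (by linarith)
  have r1 : Real.pi*(z/2) = Real.pi*z/2 := by ring
  have r2 : Real.pi*z = 2*(Real.pi*z/2) := by ring
  rw [r1] at a1 a3
  rw [show ((z/2:ℝ):ℂ)*Complex.I = (z:ℂ)*Complex.I/2 by push_cast; ring] at a1
  rw [show ((z/2:ℝ):ℂ) = (z:ℂ)/2 by push_cast; ring] at a3
  rw [← r2]
  exact ⟨a1, a2, a3, a4⟩

lemma AB_vals (z : ℝ) (hz : 0 < z) (hz1 : z ≤ 1/4) :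
    (phi ((z:ℂ)*Complex.I/2) - phi ((z:ℂ)*Complex.I)) * phi ((z:ℂ)/2) = 
      -(Real.pi:ℂ)^2*(z:ℂ)^2/16 * (tau z:ℂ) ∧
    (phi ((z:ℂ)/2) - phi (z:ℂ)) * phi ((z:ℂ)*Complex.I/2) = 
      (Real.pi:ℂ)^2*(z:ℂ)^2/16 * (1/(tau z:ℂ)) := by
  obtain ⟨p1, p2, p3, p4⟩ := phi_vals z hz hz1
  rw [p1, p2, p3, p4]
  have hpi := Real.pi_pos
  have hpi4 := Real.pi_lt_four
  have hs : Real.sinh (Real.pi*z/2) ≠ 0 := 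
    (Real.sinh_pos_iff.2 (by positivity : 0 < Real.pi*z/2)).ne'
  have hc : Real.cosh (Real.pi*z/2) ≠ 0 := (Real.cosh_pos _).ne'
  have hs2 : Real.sin (Real.pi*z/2) ≠ 0 := (Real.sin_pos_of_pos_of_lt_pi (by positivity) (by nlinarith)).ne'
  have hc2 : Real.cos (Real.pi*z/2) ≠ 0 := (Real.cos_pos_of_mem_Ioo ⟨by nlinarith, by nlinarith⟩).ne'
  have q1 := Real.cosh_sq (Real.pi*z/2)
  have q2 := Real.sin_sq_add_cos_sq (Real.pi*z/2)
  rw [Real.cosh_two_mul, Real.sinh_two_mul, Real.cos_two_mul', Real.sin_two_mul]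
  unfold tau
  generalize Real.sinh (Real.pi*z/2) = s at *
  generalize Real.cosh (Real.pi*z/2) = c at *
  generalize Real.sin (Real.pi*z/2) = s' at *
  generalize Real.cos (Real.pi*z/2) = c' at *
  constructor
  · norm_cast
    field_simp
    ring
  · norm_cast
    field_simp
    ring

lemma DA_odd (z : ℝ) (hz : 0 < z) (hz1 : z ≤ 1/4) :
    HasSum (fun j => DA (2*j+1) * ((z:ℂ)^4)^j) (-(Real.pi:ℂ)^2/32 * (tau z + 1/tau z)) := by
  obtain ⟨q1, q2⟩ := AB_vals z hz hz1
  have nz : ‖(z:ℂ)‖ < 1 := by rw [Complex.norm_real, Real.norm_of_nonneg hz.le]; linarith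
  have h1 := DA_hasSum z nz
  have h2 := DA_hasSum ((z:ℂ)*Complex.I) (by simpa using nz)
  have e1 : (z:ℂ)*Complex.I*Complex.I = -z := by rw [mul_assoc, Complex.I_mul_I]; ring
  rw [q1] at h1
  rw [e1, neg_div, phi_neg, phi_neg, q2] at h2
  have h3 := (h1.sub h2).div_const 2
  have hz0 : (z:ℂ) ≠ 0 := by exact_mod_cast hz.ne'
  have e3 : ((z:ℂ)*Complex.I)^2 = -(z:ℂ)^2 := by rw [mul_pow, Complex.I_sq]; ring
  rw [e3] at h3
  have inj : Function.Injective (fun j : ℕ => 2*j+1) := fun a b h => by simpa using h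
  have h4 := (inj.hasSum_iff (f := fun a => (DA a * ((z:ℂ)^2)^a - DA a * (-(z:ℂ)^2)^a)/2) (by
    intro m hm
    have : Even m := by
      by_contra hc
      rw [Nat.not_even_iff_odd] at hc
      obtain ⟨j, rfl⟩ := hc
      exact hm ⟨j, rfl⟩
    rw [this.neg_pow]; simp)).2 h3
  have h5 := h4.div_const ((z:ℂ)^2)
  have e4 : (fun j => DA (2*j+1) * ((z:ℂ)^4)^j) = fun j : ℕ => 
      ((fun a => (DA a * ((z:ℂ)^2)^a - DA a * (-(z:ℂ)^2)^a)/2) ∘ (fun j : ℕ => 2*j+1)) j / (z:ℂ)^2 := by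
    funext j
    simp only [Function.comp_apply]
    have e6 : ((z:ℂ)^2)^(2*j+1) = ((z:ℂ)^4)^j * (z:ℂ)^2 := by
      rw [← pow_mul, ← pow_mul, ← pow_add]
      congr 1
      ring
    rw [(odd_two_mul_add_one j).neg_pow, e6]
    have hz2 : (z:ℂ)^2 ≠ 0 := pow_ne_zero _ hz0
    generalize (z:ℂ)^2 = u at *
    field_simp
    ring
  have ht : (tau z:ℂ) ≠ 0 := by exact_mod_cast (tau_pos z hz hz1).ne'
  have e5 : -(Real.pi:ℂ)^2/32 * (tau z + 1/tau z) = (-(Real.pi:ℂ) ^ 2 * z ^ 2 / 16 * (tau z) - Real.pi ^ 2 * z ^ 2 / 16 * (1 / (tau z))) / 2 / (z:ℂ) ^ 2 := by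
    field_simp
    ring
  rw [e4, e5]
  exact h5
end ZS
end

section
open Filter Topology Finset
namespace ZS

lemma coeff_unique (e : ℕ → ℂ)
    (h : ∀ z : ℝ, 0 < z → z ≤ 1/4 → HasSum (fun n => e n * ((z:ℂ)^4)^n) 0) : ∀ n, e n = 0 := by
  intro m
  induction m using Nat.strong_induction_on with
  | _ m ih =>
  have hs : ∀ z : ℝ, 0 < z → z ≤ 1/4 → HasSum (fun n => e (n+m) * ((z:ℂ)^4)^n) 0 := by
    intro z hz hz1
    have h1 := h z hz hz1
    rw [← hasSum_nat_add_iff' m] at h1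
    have h0 : ∑ i ∈ range m, e i * ((z:ℂ)^4)^i = 0 :=
      sum_eq_zero (fun i hi => by rw [ih i (mem_range.1 hi), zero_mul])
    rw [h0, sub_zero] at h1
    have hz0 : ((z:ℂ)^4)^m ≠ 0 := pow_ne_zero _ (pow_ne_zero _ (by exact_mod_cast hz.ne'))
    have h2 := h1.div_const (((z:ℂ)^4)^m)
    rw [zero_div] at h2
    have e1 : (fun n => e (n+m) * ((z:ℂ)^4)^n) = fun n => e (n+m) * ((z:ℂ)^4)^(n+m) / ((z:ℂ)^4)^m := by
      funext n
      rw [pow_add]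
      field_simp
    rw [e1]
    exact h2
  have hb := (hs (1/4) (by norm_num) le_rfl).summable.norm
  have hw : Tendsto (fun k : ℕ => (((1/((k:ℝ)+4) : ℝ):ℂ)^4)) atTop (𝓝 0) := by
    have h1 : Tendsto (fun k : ℕ => (1/((k:ℝ)+4) : ℝ)) atTop (𝓝 0) := by
      simp only [one_div]
      exact tendsto_inv_atTop_zero.comp (tendsto_atTop_add_const_right _ _ tendsto_natCast_atTop_atTop)
    have h2 := (Complex.continuous_ofReal.tendsto 0).comp h1
    have h3 := h2.pow 4
    simpa [Function.comp_def] using h3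
  have key := tendsto_tsum_of_dominated_convergence (𝓕 := atTop)
    (f := fun (k : ℕ) (n : ℕ) => e (n+m) * (((1/((k:ℝ)+4) : ℝ):ℂ)^4)^n)
    (g := fun n => e (n+m) * (0:ℂ)^n) hb
    (fun n => (hw.pow n).const_mul _)
    (Eventually.of_forall (fun k n => by
      rw [norm_mul, norm_mul, norm_pow, norm_pow, norm_pow, norm_pow, Complex.norm_real, Complex.norm_real]
      have : ‖(1/((k:ℝ)+4) : ℝ)‖ ≤ ‖(1/4:ℝ)‖ := by
        rw [Real.norm_of_nonneg (by positivity), Real.norm_of_nonneg (by positivity)]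
        have hk : (0:ℝ) ≤ k := by positivity
        exact one_div_le_one_div_of_le (by norm_num) (by linarith)
      gcongr))
  have hz : ∀ k : ℕ, ∑' n, e (n+m) * (((1/((k:ℝ)+4) : ℝ):ℂ)^4)^n = 0 := fun k =>
    (hs _ (by positivity) (by
      apply one_div_le_one_div_of_le
      · norm_num
      · have : (0:ℝ) ≤ k := by positivity
        linarith)).tsum_eq
  simp only [hz] at key
  have h5 := tendsto_nhds_unique key tendsto_const_nhds
  rw [tsum_eq_single 0 (by intro n hn; simp [hn])] at h5
  simpa using h5

noncomputable def term3 (p : ℕ × ℕ × ℕ) : ℂ :=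
  (-1 : ℂ) ^ (p.1 + p.2.2) * (1 - 2 ^ (2 * p.1)) /
              4 ^ (p.1 + p.2.1 + p.2.2) *
              riemannZeta (2 * p.1) * riemannZeta (2 * p.2.1) *
              riemannZeta (4 * p.2.2 + 3)

noncomputable def dC (c : ℕ) : ℂ := riemannZeta (4*c+3) * (-1/4)^c

lemma reindex (n : ℕ) : ∑ p ∈ antidiagonal n, DA (2*p.1+1) * dC p.2 =
    ∑ p ∈ (Finset.range (2 * n + 2) ×ˢ Finset.range (2 * n + 2) ×ˢ
              Finset.range (2 * n + 2)).filter
              (fun p => p.1 + p.2.1 + 2 * p.2.2 = 2 * n + 1), term3 p := by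
  have e : ∀ p ∈ antidiagonal n, DA (2*p.1+1) * dC p.2 =
      ∑ q ∈ antidiagonal (2*p.1+1), term3 (q.1, q.2, p.2) := by
    intro p _
    unfold DA
    rw [sum_mul]
    refine sum_congr rfl (fun q _ => ?_)
    unfold cA cB dC term3
    simp only
    rw [div_pow, pow_add, pow_add, pow_add]
    have h4 : ∀ k : ℕ, (4:ℂ)^k ≠ 0 := fun k => pow_ne_zero _ (by norm_num)
    have := h4 q.1
    have := h4 q.2
    have := h4 p.2
    field_simp
  rw [sum_congr rfl e, sum_sigma']
  refine sum_nbij' (fun x => (x.2.1, x.2.2, x.1.2))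
    (fun p => ⟨((p.1+p.2.1-1)/2, p.2.2), (p.1, p.2.1)⟩) ?_ ?_ ?_ ?_ ?_
  · rintro ⟨⟨j, c⟩, ⟨a, b⟩⟩ h
    simp only [mem_sigma, HasAntidiagonal.mem_antidiagonal, mem_filter, mem_product, mem_range] at h ⊢
    omega
  · rintro ⟨a, b, c⟩ h
    simp only [mem_sigma, HasAntidiagonal.mem_antidiagonal, mem_filter, mem_product, mem_range] at h ⊢
    omega
  · rintro ⟨⟨j, c⟩, ⟨a, b⟩⟩ h
    simp only [mem_sigma, HasAntidiagonal.mem_antidiagonal] at h ⊢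
    have : (a+b-1)/2 = j := by omega
    rw [this]
  · rintro ⟨a, b, c⟩ h
    rfl
  · rintro ⟨⟨j, c⟩, ⟨a, b⟩⟩ h
    rfl

lemma zz_eval (n : ℕ) : ((zz n : ℝ):ℂ) = (4 - 1 / 16 ^ n) * riemannZeta (4 * n + 3)
      + 8 / (3 * riemannZeta 2) * ∑ p ∈ antidiagonal n, DA (2*p.1+1) * dC p.2 := by
  have hpi : (Real.pi:ℂ) ≠ 0 := by exact_mod_cast Real.pi_ne_zero
  have hk : 8 / (3 * riemannZeta 2) = 16/(Real.pi:ℂ)^2 := by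
    rw [riemannZeta_two]; field_simp; norm_num
  rw [hk]
  have := coeff_unique (fun n => ((zz n : ℝ):ℂ) - ((4 - 1 / 16 ^ n) * riemannZeta (4 * n + 3)
      + 16/(Real.pi:ℂ)^2 * ∑ p ∈ antidiagonal n, DA (2*p.1+1) * dC p.2)) ?_ n
  · exact sub_eq_zero.1 this
  intro z hz hz1
  have nz : ‖(z:ℂ)^4‖ < 1 := by
    rw [norm_pow, Complex.norm_real, Real.norm_of_nonneg hz.le]
    exact pow_lt_one₀ hz.le (by linarith) (by norm_num)
  obtain ⟨C, hC⟩ := gam_bdd z hz hz1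
  have g1 := (zz_hasSum (Y := z^2) (by positivity) (by nlinarith) C hC).1
  have g2 := Complex.hasSum_ofReal.2 g1
  rw [G_eq_SS z hz hz1, SS_eval z hz hz1 _ _ (eP_lim z hz hz1) (eN_lim z hz hz1)] at g2
  have a1 := (Zf_hasSum ((z:ℂ)^4) nz).mul_left 4
  have a2 := Zf_hasSum ((z:ℂ)^4/16) (by rw [norm_div]; norm_num; rw [norm_pow] at nz; simp at nz; linarith)
  have a3 := Zf_hasSum (-(z:ℂ)^4/4) (by rw [norm_div, norm_neg]; norm_num; rw [norm_pow] at nz; simp at nz; linarith)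
  have a3' : HasSum (fun c => dC c * ((z:ℂ)^4)^c) (Zf (-(z:ℂ)^4/4)) := by
    have e1 : (fun c => dC c * ((z:ℂ)^4)^c) = fun c : ℕ => riemannZeta (4*c+3) * (-(z:ℂ)^4/4)^c := by
      funext c
      unfold dC
      rw [mul_assoc, ← mul_pow]
      congr 2
      ring
    rw [e1]
    exact a3
  have a4 := (hasSum_cauchy (DA_odd z hz hz1) a3').mul_left (16/(Real.pi:ℂ)^2)
  have a5 := g2.sub ((a1.sub a2).add a4)
  have ht : (tau z:ℂ) ≠ 0 := by exact_mod_cast (tau_pos z hz hz1).ne'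
  have v0 : (4 * Zf ((z:ℂ) ^ 4) - Zf ((z:ℂ) ^ 4 / 16) - ((tau z:ℂ) - -(1 / (tau z:ℂ))) / 2 * Zf (-(z:ℂ) ^ 4 / 4) -
      (4 * Zf ((z:ℂ) ^ 4) - Zf ((z:ℂ) ^ 4 / 16) +
        16 / (Real.pi:ℂ) ^ 2 * (-(Real.pi:ℂ) ^ 2 / 32 * ((tau z:ℂ) + 1 / (tau z:ℂ)) * Zf (-(z:ℂ) ^ 4 / 4)))) = 0 := by
    field_simp
    ring
  rw [v0] at a5
  refine (congrArg (fun f : ℕ → ℂ => HasSum f 0) (funext (fun b => ?_))).mp a5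
  have e1 : (((((z ^ 2) ^ 2) ^ b * zz b : ℝ)):ℂ) = ((z:ℂ)^4)^b * (zz b:ℂ) := by
    push_cast
    rw [← pow_mul (z:ℂ) 2 2]
  rw [e1, div_pow]
  generalize ∑ p ∈ HasAntidiagonal.antidiagonal b, DA (2 * p.1 + 1) * dC p.2 = S
  ring
end ZS
end

/-- The evaluation of `ζ⋆({1,3}^n, 1, 2)` in terms of Riemann zeta
values (with the convention `ζ(0) = −1/2`, which `riemannZeta` satisfies). -/
theorem zetaStar_1313_1_2 (n : ℕ) :
    ((zetaStar (Fin.snoc (Fin.snoc (pat13 n) 1) 2) : ℝ) : ℂ) =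
      (4 - 1 / 16 ^ n) * riemannZeta (4 * n + 3)
      + 8 / (3 * riemannZeta 2) *
          ∑ p ∈ (Finset.range (2 * n + 2) ×ˢ Finset.range (2 * n + 2) ×ˢ
              Finset.range (2 * n + 2)).filter
              (fun p => p.1 + p.2.1 + 2 * p.2.2 = 2 * n + 1),
            (-1 : ℂ) ^ (p.1 + p.2.2) * (1 - 2 ^ (2 * p.1)) /
              4 ^ (p.1 + p.2.1 + p.2.2) *
              riemannZeta (2 * p.1) * riemannZeta (2 * p.2.1) *
              riemannZeta (4 * p.2.2 + 3) := by
  rw [ZS.zetaStar_zz n, ZS.zz_eval n, ZS.reindex n]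
  rfl
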